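/- arXiv:2108.08050 — 8 statements merged into one kernel-verified Lean document; each statement's English description precedes it below -/
import Mathlib

section
/- Let S be a finite f-fat family of objects in ℝ^d, each of positive size. Suppose I ⊆ S is pairwise disjoint and greedily maximal, i.e., every s ∈ S intersects some i ∈ I with size(i) ≤ size(s). Then every pairwise disjoint subfamily J ⊆ S satisfies |J| ≤ f·|I|. In particular, the greedy independent set I is a (1/f)-approximate maximum independent set of S. -/
open scoped Classical

/-- Axis-aligned hypercube of side length `r` centered at `c` (ℓ∞ metric on `Fin d → ℝ`). -/
def cube {d : ℕ} (c : Fin d → ℝ) (r : ℝ) : Set (Fin d → ℝ) :=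
  {x | dist x c ≤ r / 2}

/-- The size of a set: the side length of a minimal enclosing axis-aligned hypercube. -/
noncomputable def cubeSize {d : ℕ} (A : Set (Fin d → ℝ)) : ℝ :=
  sInf {r : ℝ | 0 ≤ r ∧ ∃ c : Fin d → ℝ, A ⊆ cube c r}

/-- An object: a nonempty compact connected subset of `ℝ^d`. -/
def IsObject {d : ℕ} (A : Set (Fin d → ℝ)) : Prop :=
  A.Nonempty ∧ IsCompact A ∧ IsConnected A

/-- A finite family `S` of objects is `f`-fat if for every hypercube `□(c,r)` with `r > 0`
there are at most `f` points such that every member of `S` intersecting `□(c,r)` and of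
size at least `r` contains one of the points. -/
def IsFatFam {d : ℕ} (f : ℕ) (S : Finset (Set (Fin d → ℝ))) : Prop :=
  ∀ (c : Fin d → ℝ) (r : ℝ), 0 < r →
    ∃ P : Finset (Fin d → ℝ), P.card ≤ f ∧
      ∀ A ∈ S, (A ∩ cube c r).Nonempty → r ≤ cubeSize A → ∃ p ∈ P, p ∈ A

theorem subset_cube_of_pos {d : ℕ} (A : Set (Fin d → ℝ)) (h : 0 < cubeSize A) :
    ∃ c : Fin d → ℝ, A ⊆ cube c (cubeSize A) := by
  have hne : {r : ℝ | 0 ≤ r ∧ ∃ c : Fin d → ℝ, A ⊆ cube c r}.Nonempty := by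
    by_contra hn
    rw [Set.not_nonempty_iff_eq_empty] at hn
    unfold cubeSize at h
    rw [hn, Real.sInf_empty] at h
    exact lt_irrefl _ h
  refine ⟨fun k => (sInf ((fun x => x k) '' A) + sSup ((fun x => x k) '' A)) / 2, ?_⟩
  intro x hx
  have key : 2 * dist x (fun k => (sInf ((fun x => x k) '' A) + sSup ((fun x => x k) '' A)) / 2)
      ≤ cubeSize A := by
    refine le_csInf hne ?_
    rintro r ⟨hr, c, hc⟩
    have : dist x (fun k => (sInf ((fun x => x k) '' A) + sSup ((fun x => x k) '' A)) / 2)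
        ≤ r / 2 := by
      rw [dist_pi_le_iff (by linarith)]
      intro k
      have hb : ∀ y ∈ A, c k - r / 2 ≤ y k ∧ y k ≤ c k + r / 2 := by
        intro y hy
        have h1 : dist (y k) (c k) ≤ r / 2 := (dist_le_pi_dist y c k).trans (hc hy)
        rw [Real.dist_eq, abs_le] at h1
        constructor <;> linarith [h1.1, h1.2]
      have hl : c k - r / 2 ∈ lowerBounds ((fun x => x k) '' A) := by
        rintro _ ⟨y, hy, rfl⟩
        exact (hb y hy).1
      have hu : c k + r / 2 ∈ upperBounds ((fun x => x k) '' A) := by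
        rintro _ ⟨y, hy, rfl⟩
        exact (hb y hy).2
      have hm : x k ∈ (fun x : Fin d → ℝ => x k) '' A := ⟨x, hx, rfl⟩
      have a1 := csInf_le ⟨_, hl⟩ hm
      have a2 := le_csSup ⟨_, hu⟩ hm
      have a3 := le_csInf ⟨_, hm⟩ hl
      have a4 := csSup_le ⟨_, hm⟩ hu
      rw [Real.dist_eq, abs_le]
      constructor <;> linarith
    linarith
  show dist _ _ ≤ _
  linarith

/-- The greedy algorithm returns a `(1/f)`-approximate maximum independent set:
if `I ⊆ S` is pairwise disjoint and every `s ∈ S` intersects some `i ∈ I` with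
`cubeSize i ≤ cubeSize s`, then every pairwise disjoint `J ⊆ S` has `|J| ≤ f·|I|`. -/
theorem greedy_approx {d f : ℕ} (S : Finset (Set (Fin d → ℝ)))
    (hfat : IsFatFam f S) (hobj : ∀ A ∈ S, IsObject A)
    (hpos : ∀ A ∈ S, 0 < cubeSize A)
    (I : Finset (Set (Fin d → ℝ))) (hIS : I ⊆ S)
    (hIdisj : (I : Set (Set (Fin d → ℝ))).Pairwise Disjoint)
    (hgreedy : ∀ s ∈ S, ∃ i ∈ I, (s ∩ i).Nonempty ∧ cubeSize i ≤ cubeSize s)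
    (J : Finset (Set (Fin d → ℝ))) (hJS : J ⊆ S)
    (hJdisj : (J : Set (Set (Fin d → ℝ))).Pairwise Disjoint) :
    J.card ≤ f * I.card := by
  choose! g hgI hgn hgs using hgreedy
  refine Finset.card_le_mul_card_image_of_maps_to (f := g) (fun a ha => hgI a (hJS ha)) f ?_
  intro i hi
  obtain ⟨c, hc⟩ := subset_cube_of_pos i (hpos i (hIS hi))
  obtain ⟨P, hPf, hP⟩ := hfat c (cubeSize i) (hpos i (hIS hi))
  have hex : ∀ a ∈ J.filter (fun a => g a = i), ∃ p ∈ P, p ∈ a := by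
    intro a ha
    rw [Finset.mem_filter] at ha
    obtain ⟨haJ, rfl⟩ := ha
    exact hP a (hJS haJ) ((hgn a (hJS haJ)).mono (Set.inter_subset_inter_right _ hc))
      (hgs a (hJS haJ))
  choose! q hqP hqa using hex
  refine le_trans (Finset.card_le_card_of_injOn q hqP ?_) hPf
  intro a ha b hb hab
  by_contra hne
  have ha' := (Finset.mem_filter.1 ha).1
  have hb' := (Finset.mem_filter.1 hb).1
  exact Set.disjoint_left.1 (hJdisj ha' hb' hne) (hqa a ha) (hab ▸ hqa b hb)
end

section
/- Let S₁ and S₂ be finite f-fat families of objects in ℝ^d, each of which is pairwise disjoint, and set n = |S₁| + |S₂| with n ≥ 1. For every c ∈ ℝ^d and r > 0 there exists r′ with r ≤ r′ ≤ 2r such that the number of members of S₁ ∪ S₂ that intersect the boundary ∂□(c,r′) is at most (f·d·4^d + 2)·n^{1 − 1/d}. -/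
open scoped Classical

theorem esc_oneD (K : ℕ) (hK : 1 ≤ K) (s : ℝ) (hs : 0 < s) (y : ℝ) (h0 : 0 ≤ y) (h1 : y ≤ K * s) :
    ∃ k : Fin K, |y - ((k : ℕ) + 1 / 2) * s| ≤ s / 2 := by
  have key : ∃ k : ℕ, k < K ∧ k * s ≤ y ∧ y ≤ (k + 1) * s := by
    by_cases hlt : y < K * s
    · refine ⟨⌊y / s⌋₊, ?_, ?_, ?_⟩
      · rw [Nat.floor_lt (by positivity)]
        rwa [div_lt_iff₀ hs]
      · rw [← le_div_iff₀ hs]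
        exact Nat.floor_le (by positivity)
      · rw [← div_le_iff₀ hs]
        exact (Nat.lt_floor_add_one _).le
    · refine ⟨K - 1, by omega, ?_, ?_⟩
      · push_cast [Nat.cast_sub hK]
        nlinarith
      · push_cast [Nat.cast_sub hK]
        nlinarith
  obtain ⟨k, hk, h2, h3⟩ := key
  refine ⟨⟨k, hk⟩, ?_⟩
  rw [abs_le]
  constructor <;> simp only <;> nlinarith

theorem esc_cover {d : ℕ} (hd : 1 ≤ d) (c : Fin d → ℝ) (t s : ℝ) (ht : 0 < t) (hs : 0 < s)
    (K : ℕ) (hK : 1 ≤ K) (hKt : t ≤ K * s) :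
    ∃ C : Finset (Fin d → ℝ), C.card ≤ d * (2 * K ^ (d - 1)) ∧
      ∀ x, dist x c = t / 2 → ∃ z ∈ C, x ∈ cube z s := by
  let g : (Σ i : Fin d, Bool × ({j : Fin d // j ≠ i} → Fin K)) → (Fin d → ℝ) :=
    fun p j => if h : j ≠ p.1 then c j - t / 2 + ((p.2.2 ⟨j, h⟩ : ℕ) + 1 / 2) * s
      else if p.2.1 then c j + t / 2 else c j - t / 2
  refine ⟨Finset.univ.image g, ?_, ?_⟩
  · refine Finset.card_image_le.trans ?_
    rw [Finset.card_univ, Fintype.card_sigma]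
    simp [Fintype.card_subtype_compl]
  · intro x hx
    have hle : ∀ j, |x j - c j| ≤ t / 2 := by
      intro j
      rw [← hx, ← Real.dist_eq]
      exact dist_le_pi_dist x c j
    have hex : ∃ i, |x i - c i| = t / 2 := by
      by_contra hne
      push Not at hne
      have : dist x c < t / 2 := by
        rw [dist_pi_lt_iff (by positivity)]
        intro b
        rw [Real.dist_eq]
        exact lt_of_le_of_ne (hle b) (hne b)
      linarith
    obtain ⟨i, hi⟩ := hex
    have hc : ∀ j : {j : Fin d // j ≠ i}, ∃ k : Fin K,
        |(x j - c j + t / 2) - ((k : ℕ) + 1 / 2) * s| ≤ s / 2 := by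
      intro j
      have := abs_le.1 (hle j)
      exact esc_oneD K hK s hs _ (by linarith) (by linarith)
    choose k hk using hc
    refine ⟨g ⟨i, decide (0 ≤ x i - c i), k⟩, Finset.mem_image_of_mem _ (Finset.mem_univ _), ?_⟩
    simp only [cube, Set.mem_setOf_eq]
    rw [dist_pi_le_iff (by positivity)]
    intro j
    rw [Real.dist_eq]
    by_cases h : j = i
    · subst h
      by_cases hp : 0 ≤ x j - c j
      · rw [abs_of_nonneg hp] at hi
        have : x j - (c j + t / 2) = 0 := by linarith
        simp only [g, ne_eq, not_true_eq_false, dite_false, hp, decide_true, if_true, this, abs_zero]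
        positivity
      · rw [abs_of_neg (not_le.1 hp)] at hi
        have : x j - (c j - t / 2) = 0 := by linarith
        simp [g, hp, this]
        positivity
    · have := hk ⟨j, h⟩
      simp only [g, ne_eq, h, not_false_eq_true, dite_true]
      convert this using 2
      ring

theorem esc_big {d f : ℕ} (S : Finset (Set (Fin d → ℝ))) (hfat : IsFatFam f S)
    (hdisj : (S : Set (Set (Fin d → ℝ))).Pairwise Disjoint) (s : ℝ) (hs : 0 < s)
    (C : Finset (Fin d → ℝ)) :
    (S.filter (fun A => s ≤ cubeSize A ∧ ∃ z ∈ C, (A ∩ cube z s).Nonempty)).card ≤ C.card * f := by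
  have h1 : S.filter (fun A => s ≤ cubeSize A ∧ ∃ z ∈ C, (A ∩ cube z s).Nonempty) ⊆
      C.biUnion (fun z => S.filter (fun A => s ≤ cubeSize A ∧ (A ∩ cube z s).Nonempty)) := by
    intro A hA
    simp only [Finset.mem_filter, Finset.mem_biUnion] at hA ⊢
    obtain ⟨hS, h, z, hz, hz'⟩ := hA
    exact ⟨z, hz, hS, h, hz'⟩
  refine (Finset.card_le_card h1).trans (Finset.card_biUnion_le_card_mul _ _ _ ?_)
  intro z _
  obtain ⟨P, hP, hP'⟩ := hfat z s hs
  refine le_trans ?_ hP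
  have hch : ∀ A : Set (Fin d → ℝ), ∃ p, A ∈ S.filter (fun A => s ≤ cubeSize A ∧ (A ∩ cube z s).Nonempty) →
      p ∈ P ∧ p ∈ A := by
    intro A
    by_cases hA : A ∈ S.filter (fun A => s ≤ cubeSize A ∧ (A ∩ cube z s).Nonempty)
    · have hA' := Finset.mem_filter.1 hA
      obtain ⟨p, hp, hpA⟩ := hP' A hA'.1 hA'.2.2 hA'.2.1
      exact ⟨p, fun _ => ⟨hp, hpA⟩⟩
    · exact ⟨z, fun h => absurd h hA⟩
  choose g hg using hch
  refine Finset.card_le_card_of_injOn g (fun A hA => (hg A hA).1) ?_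
  intro A hA B hB hAB
  by_contra hne
  have hd := hdisj (Finset.mem_filter.1 hA).1 (Finset.mem_filter.1 hB).1 hne
  refine Set.disjoint_left.1 hd (hg A hA).2 ?_
  rw [hAB]
  exact (hg B hB).2

theorem esc_small {d : ℕ} (A : Set (Fin d → ℝ)) (hA : IsObject A) (s : ℝ) (h : cubeSize A < s)
    (c : Fin d → ℝ) : ∃ a : ℝ, ∀ x ∈ A, a ≤ 2 * dist x c ∧ 2 * dist x c ≤ a + 2 * s := by
  have hne : {r : ℝ | 0 ≤ r ∧ ∃ c : Fin d → ℝ, A ⊆ cube c r}.Nonempty := by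
    obtain ⟨R, hR⟩ := hA.2.1.isBounded.subset_closedBall c
    refine ⟨2 * max R 0, by positivity, c, fun x hx => ?_⟩
    have := hR hx
    rw [Metric.mem_closedBall] at this
    simp only [cube, Set.mem_setOf_eq]
    have := le_max_left R 0
    linarith
  obtain ⟨q, ⟨hq0, z, hz⟩, hqs⟩ := exists_lt_of_csInf_lt hne h
  refine ⟨2 * dist z c - s, fun x hx => ?_⟩
  have h1 : dist x z ≤ q / 2 := hz hx
  have h2 := dist_triangle x z c
  have h3 := dist_triangle z x c
  rw [dist_comm z x] at h3
  constructor <;> linarith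

theorem esc_avg {ι : Type*} (T : Finset ι) (a : ι → ℝ) (L r : ℝ) (hL : 0 ≤ L) (hr : 0 < r) :
    ∃ t ∈ Set.Icc r (2 * r),
      ((T.filter (fun i => t ∈ Set.Icc (a i) (a i + L))).card : ℝ) ≤ T.card * L / r := by
  let F : ℝ → ℝ := fun t => ∑ i ∈ T, (Set.Icc (a i) (a i + L)).indicator (fun _ => (1 : ℝ)) t
  have hint : ∀ i, MeasureTheory.IntegrableOn ((Set.Icc (a i) (a i + L)).indicator (fun _ => (1 : ℝ)))
      (Set.Icc r (2 * r)) := by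
    intro i
    refine MeasureTheory.Integrable.indicator ?_ measurableSet_Icc
    simp [MeasureTheory.integrable_const_iff, MeasureTheory.isFiniteMeasure_restrict]
  have hvol : MeasureTheory.volume (Set.Icc r (2 * r)) = ENNReal.ofReal r := by
    rw [Real.volume_Icc]; congr 1; ring
  obtain ⟨t, ht, hle⟩ := MeasureTheory.exists_le_setAverage (μ := MeasureTheory.volume)
    (s := Set.Icc r (2 * r)) (f := F) (by rw [hvol]; simpa using hr) (by rw [hvol]; simp)
    (MeasureTheory.integrable_finset_sum _ (fun i _ => hint i))
  refine ⟨t, ht, ?_⟩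
  have hF : F t = ((T.filter (fun i => t ∈ Set.Icc (a i) (a i + L))).card : ℝ) := by
    simp only [F, Set.indicator_apply, Finset.sum_boole]
  rw [← hF]
  refine hle.trans ?_
  rw [MeasureTheory.setAverage_eq, MeasureTheory.measureReal_def, hvol, ENNReal.toReal_ofReal hr.le,
    smul_eq_mul, MeasureTheory.integral_finset_sum _ (fun i _ => hint i), inv_mul_eq_div]
  gcongr
  rw [← nsmul_eq_mul]
  refine Finset.sum_le_card_nsmul _ _ _ (fun i _ => ?_)
  rw [MeasureTheory.integral_indicator measurableSet_Icc]
  simp only [MeasureTheory.integral_const, smul_eq_mul, mul_one]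
  rw [MeasureTheory.measureReal_restrict_apply MeasurableSet.univ, Set.univ_inter,
    ]
  rw [MeasureTheory.measureReal_restrict_apply measurableSet_Icc]
  refine (MeasureTheory.measureReal_mono Set.inter_subset_left (by simp)).trans ?_
  simp [hL]

/-- Existence part of Lemma `getroot`: in any hyperannulus between `□(c,r)` and
`□(c,2r)` there is a hypercube whose boundary meets at most
`(f·d·4^d + 2)·n^{1-1/d}` objects of `S₁ ∪ S₂`. -/
theorem exists_separating_cube {d f : ℕ} (hd : 1 ≤ d)
    (S₁ S₂ : Finset (Set (Fin d → ℝ)))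
    (hfat₁ : IsFatFam f S₁) (hfat₂ : IsFatFam f S₂)
    (hobj₁ : ∀ A ∈ S₁, IsObject A) (hobj₂ : ∀ A ∈ S₂, IsObject A)
    (hdisj₁ : (S₁ : Set (Set (Fin d → ℝ))).Pairwise Disjoint)
    (hdisj₂ : (S₂ : Set (Set (Fin d → ℝ))).Pairwise Disjoint)
    (n : ℕ) (hn : n = S₁.card + S₂.card) (hn1 : 1 ≤ n)
    (c : Fin d → ℝ) (r : ℝ) (hr : 0 < r) :
    ∃ r' : ℝ, r ≤ r' ∧ r' ≤ 2 * r ∧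
      (({A : Set (Fin d → ℝ) | A ∈ S₁ ∪ S₂ ∧
          (A ∩ frontier (cube c r')).Nonempty}.ncard : ℝ)) ≤
        ((f : ℝ) * d * 4 ^ d + 2) * (n : ℝ) ^ (1 - 1 / (d : ℝ)) := by
  have hd0 : (0 : ℝ) < d := by exact_mod_cast hd
  have hn1' : (1 : ℝ) ≤ n := by exact_mod_cast hn1
  obtain ⟨m, hm⟩ : ∃ m : ℝ, m = (n : ℝ) ^ (1 / (d : ℝ)) := ⟨_, rfl⟩
  have hm1 : 1 ≤ m := by rw [hm]; exact Real.one_le_rpow hn1' (by positivity)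
  have hm0 : 0 < m := by linarith
  have hmd : m ^ d = n := by
    rw [hm, ← Real.rpow_natCast, ← Real.rpow_mul (by positivity)]
    rw [one_div, inv_mul_cancel₀ hd0.ne', Real.rpow_one]
  have hpow : (n : ℝ) ^ (1 - 1 / (d : ℝ)) = n / m := by
    rw [Real.rpow_sub (by linarith), Real.rpow_one, hm]
  have hpow' : (n : ℝ) / m = m ^ (d - 1) := by
    rw [← hmd, div_eq_iff hm0.ne', ← pow_succ, Nat.sub_add_cancel hd]
  obtain ⟨s, hs⟩ : ∃ s : ℝ, s = r / m := ⟨_, rfl⟩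
  have hs0 : 0 < s := by rw [hs]; positivity
  have hobj : ∀ A ∈ S₁ ∪ S₂, IsObject A := by
    intro A hA
    rcases Finset.mem_union.1 hA with h | h
    exacts [hobj₁ A h, hobj₂ A h]
  have hsm : ∀ A : Set (Fin d → ℝ), ∃ a : ℝ, A ∈ (S₁ ∪ S₂).filter (fun A => cubeSize A < s) →
      ∀ x ∈ A, a ≤ 2 * dist x c ∧ 2 * dist x c ≤ a + 2 * s := by
    intro A
    by_cases hA : A ∈ (S₁ ∪ S₂).filter (fun A => cubeSize A < s)
    · have hA' := Finset.mem_filter.1 hA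
      obtain ⟨a, ha⟩ := esc_small A (hobj A hA'.1) s hA'.2 c
      exact ⟨a, fun _ => ha⟩
    · exact ⟨0, fun h => absurd h hA⟩
  choose a ha using hsm
  obtain ⟨t, ht, havg⟩ := esc_avg ((S₁ ∪ S₂).filter (fun A => cubeSize A < s)) a (2 * s) r
    (by linarith) hr
  refine ⟨t, ht.1, ht.2, ?_⟩
  have ht0 : 0 < t := lt_of_lt_of_le hr ht.1
  obtain ⟨K, hKdef⟩ : ∃ K : ℕ, K = ⌈2 * m⌉₊ := ⟨_, rfl⟩
  have hK2 : 2 * m ≤ K := by rw [hKdef]; exact Nat.le_ceil _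
  have hK4 : (K : ℝ) ≤ 4 * m := by
    have := Nat.ceil_lt_add_one (a := 2 * m) (by positivity)
    rw [← hKdef] at this
    linarith
  have hK1 : 1 ≤ K := by
    have : (1 : ℝ) ≤ K := by linarith
    exact_mod_cast this
  have hms : m * s = r := by rw [hs]; field_simp
  have hKt : t ≤ K * s := by
    have := mul_le_mul_of_nonneg_right hK2 hs0.le
    have := ht.2
    linarith
  obtain ⟨C, hC, hcov⟩ := esc_cover hd c t s ht0 hs0 K hK1 hKt
  have hfr : ∀ x ∈ frontier (cube c t), dist x c = t / 2 := by
    intro x hx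
    exact Metric.mem_sphere.1 (Metric.frontier_closedBall_subset_sphere hx)
  have hsub : {A : Set (Fin d → ℝ) | A ∈ S₁ ∪ S₂ ∧ (A ∩ frontier (cube c t)).Nonempty} ⊆
      (((((S₁ ∪ S₂).filter (fun A => cubeSize A < s)).filter
          (fun A => t ∈ Set.Icc (a A) (a A + 2 * s))) ∪
        (S₁.filter (fun A => s ≤ cubeSize A ∧ ∃ z ∈ C, (A ∩ cube z s).Nonempty)) ∪
        (S₂.filter (fun A => s ≤ cubeSize A ∧ ∃ z ∈ C, (A ∩ cube z s).Nonempty)) :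
        Finset (Set (Fin d → ℝ))) : Set (Set (Fin d → ℝ))) := by
    rintro A ⟨hA, x, hxA, hx⟩
    have hxd := hfr x hx
    rw [Finset.mem_coe, Finset.mem_union, Finset.mem_union]
    by_cases hsz : cubeSize A < s
    · left; left
      have hA' : A ∈ (S₁ ∪ S₂).filter (fun A => cubeSize A < s) := Finset.mem_filter.2 ⟨hA, hsz⟩
      refine Finset.mem_filter.2 ⟨hA', ?_⟩
      have := ha A hA' x hxA
      rw [hxd] at this
      exact ⟨by linarith [this.1], by linarith [this.2]⟩
    · obtain ⟨z, hz, hxz⟩ := hcov x hxd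
      have hb : s ≤ cubeSize A ∧ ∃ z ∈ C, (A ∩ cube z s).Nonempty :=
        ⟨not_lt.1 hsz, z, hz, x, hxA, hxz⟩
      rcases Finset.mem_union.1 hA with h | h
      · left; right; exact Finset.mem_filter.2 ⟨h, hb⟩
      · right; exact Finset.mem_filter.2 ⟨h, hb⟩
  have hcard := Set.ncard_le_ncard hsub (Finset.finite_toSet _)
  rw [Set.ncard_coe_finset] at hcard
  have hcard2 := hcard.trans ((Finset.card_union_le _ _).trans
    (Nat.add_le_add_right (Finset.card_union_le _ _) _))
  have hb1 := esc_big S₁ hfat₁ hdisj₁ s hs0 C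
  have hb2 := esc_big S₂ hfat₂ hdisj₂ s hs0 C
  have hcR : (C.card : ℝ) ≤ d * (2 * (4 * m) ^ (d - 1)) := by
    have h1 : (C.card : ℝ) ≤ d * (2 * (K : ℝ) ^ (d - 1)) := by exact_mod_cast hC
    refine h1.trans ?_
    gcongr
  have hTn : (((S₁ ∪ S₂).filter (fun A => cubeSize A < s)).card : ℝ) ≤ n := by
    have := (Finset.card_filter_le (S₁ ∪ S₂) (fun A => cubeSize A < s)).trans
      (Finset.card_union_le S₁ S₂)
    rw [← hn] at this
    exact_mod_cast this
  have hsmall : (((S₁ ∪ S₂).filter (fun A => cubeSize A < s)).card : ℝ) * (2 * s) / r ≤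
      2 * (n / m) := by
    have h1 : (n : ℝ) * (2 * s) / r = 2 * (n / m) := by rw [hs]; field_simp
    rw [← h1]
    gcongr
  have htot : (({A : Set (Fin d → ℝ) | A ∈ S₁ ∪ S₂ ∧
      (A ∩ frontier (cube c t)).Nonempty}.ncard : ℝ)) ≤
      2 * (n / m) + C.card * f + C.card * f := by
    have h1 := hcard2.trans (Nat.add_le_add (Nat.add_le_add_left hb1 _) hb2)
    have h2 : (({A : Set (Fin d → ℝ) | A ∈ S₁ ∪ S₂ ∧
      (A ∩ frontier (cube c t)).Nonempty}.ncard : ℝ)) ≤ _ := Nat.cast_le.2 h1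
    push_cast at h2
    have h3 := havg.trans hsmall
    linarith
  refine htot.trans ?_
  have h4 : (4 : ℝ) ^ d = 4 * 4 ^ (d - 1) := by
    rw [← pow_succ', Nat.sub_add_cancel hd]
  have h5 := mul_le_mul_of_nonneg_right hcR (Nat.cast_nonneg (α := ℝ) f)
  rw [hpow, hpow', h4]
  rw [mul_pow] at h5
  linarith
end

section
/- Let S₁ and S₂ be finite f-fat families of objects in ℝ^d, each of which is pairwise disjoint, and set n = |S₁| + |S₂| with n ≥ 1. Then there exist c ∈ ℝ^d and r > 0 such that, for the hypercube s = □(c,r): (i) at most (f·d·4^d + 2)·n^{1 − 1/d} members of S₁ ∪ S₂ intersect the boundary ∂s; (ii) at most ((4^d − 1)/4^d)·|S₁| members of S₁ are contained in the interior of s; and (iii) at most ((4^d − 1)/4^d)·|S₁| members of S₁ are disjoint from s (lie entirely outside s). -/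
open scoped Classical

section helpers

lemma xx_cube_eq {d : ℕ} (c : Fin d → ℝ) (r : ℝ) : cube c r = Metric.closedBall c (r / 2) := rfl

lemma xx_grid (K : ℕ) (hK : 1 ≤ K) (δ t : ℝ) (hδ : 0 < δ) (h0 : 0 ≤ t) (h1 : t ≤ K * δ) :
    ∃ g : Fin K, |t - ((g : ℕ) + 1 / 2) * δ| ≤ δ / 2 := by
  by_cases h : t = K * δ
  · refine ⟨⟨K - 1, by omega⟩, ?_⟩
    have : ((K - 1 : ℕ) : ℝ) = K - 1 := by push_cast [hK]; ring
    simp only [this, h]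
    rw [abs_le]; constructor <;> nlinarith
  · have hlt : t / δ < K := by rw [div_lt_iff₀ hδ]; exact lt_of_le_of_ne h1 h
    have hnn : 0 ≤ t / δ := by positivity
    refine ⟨⟨⌊t / δ⌋₊, (Nat.floor_lt hnn).2 hlt⟩, ?_⟩
    have a := Nat.floor_le hnn
    have b := Nat.lt_floor_add_one (t / δ)
    rw [le_div_iff₀ hδ] at a
    rw [div_lt_iff₀ hδ] at b
    simp only
    rw [abs_le]; constructor <;> nlinarith

lemma xx_avg {ι : Type*} (T : Finset ι) (a : ι → ℝ) (L r0 : ℝ) (hL : 0 ≤ L) (hr : 0 < r0) :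
    ∃ r ∈ Set.Icc r0 (2 * r0),
      ((T.filter (fun i => r ∈ Set.Icc (a i) (a i + L))).card : ℝ) ≤ T.card * L / r0 := by
  have hvol : MeasureTheory.volume (Set.Icc r0 (2 * r0)) = ENNReal.ofReal r0 := by
    rw [Real.volume_Icc]; congr 1; ring
  let F : ℝ → ENNReal := fun r => ∑ i ∈ T, (Set.Icc (a i) (a i + L)).indicator 1 r
  have hF : Measurable F := by
    refine Finset.measurable_fun_sum T fun i _ => ?_
    exact measurable_one.indicator measurableSet_Icc
  obtain ⟨r, hrm, hle⟩ := MeasureTheory.exists_le_setLAverage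
    (μ := MeasureTheory.volume) (s := Set.Icc r0 (2 * r0)) (f := F)
    (by rw [hvol]; simpa using hr) (by rw [hvol]; simp) hF.aemeasurable
  refine ⟨r, hrm, ?_⟩
  have hint : ∫⁻ x in Set.Icc r0 (2 * r0), F x ≤ T.card * ENNReal.ofReal L := by
    calc ∫⁻ x in Set.Icc r0 (2 * r0), F x ≤ ∫⁻ x, F x := MeasureTheory.setLIntegral_le_lintegral _ _
      _ = ∑ i ∈ T, ∫⁻ x, (Set.Icc (a i) (a i + L)).indicator 1 x :=
          MeasureTheory.lintegral_finsetSum T fun i _ => measurable_one.indicator measurableSet_Icc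
      _ = ∑ i ∈ T, ENNReal.ofReal L := by
          refine Finset.sum_congr rfl fun i _ => ?_
          rw [MeasureTheory.lintegral_indicator_one measurableSet_Icc, Real.volume_Icc]
          congr 1; ring
      _ = _ := by simp
  have hFr : F r = ((T.filter (fun i => r ∈ Set.Icc (a i) (a i + L))).card : ENNReal) := by
    simp only [F, Set.indicator_apply, Pi.one_apply]
    rw [Finset.sum_boole]
  rw [MeasureTheory.setLAverage_eq, hvol, hFr] at hle
  have h2 := hle.trans (ENNReal.div_le_div_right hint _)
  rw [← ENNReal.ofReal_natCast, ← ENNReal.ofReal_natCast, ← ENNReal.ofReal_mul (by positivity),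
    ← ENNReal.ofReal_div_of_pos hr, ENNReal.ofReal_le_ofReal_iff (by positivity)] at h2
  exact h2

lemma xx_large {d f : ℕ} {S : Finset (Set (Fin d → ℝ))} (hfat : IsFatFam f S)
    (hdisj : (S : Set (Set (Fin d → ℝ))).Pairwise Disjoint) {ι : Type*} [Fintype ι]
    (e : ι → Fin d → ℝ) (δ : ℝ) (hδ : 0 < δ) :
    (S.filter (fun A => δ ≤ cubeSize A ∧ ∃ i, (A ∩ cube (e i) δ).Nonempty)).card
      ≤ Fintype.card ι * f := by
  have h1 : S.filter (fun A => δ ≤ cubeSize A ∧ ∃ i, (A ∩ cube (e i) δ).Nonempty) ⊆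
      Finset.univ.biUnion (fun i => S.filter (fun A => δ ≤ cubeSize A ∧ (A ∩ cube (e i) δ).Nonempty)) := by
    intro A hA
    simp only [Finset.mem_filter, Finset.mem_biUnion, Finset.mem_univ, true_and] at hA ⊢
    obtain ⟨a, b, i, h⟩ := hA
    exact ⟨i, a, b, h⟩
  refine (Finset.card_le_card h1).trans ?_
  refine (Finset.card_biUnion_le_card_mul _ _ f fun i _ => ?_).trans (by simp)
  obtain ⟨P, hP, h⟩ := hfat (e i) δ hδ
  have h' : ∀ A, ∃ p, A ∈ S.filter (fun A => δ ≤ cubeSize A ∧ (A ∩ cube (e i) δ).Nonempty) →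
      p ∈ P ∧ p ∈ A := by
    intro A
    by_cases hA : A ∈ S.filter (fun A => δ ≤ cubeSize A ∧ (A ∩ cube (e i) δ).Nonempty)
    · have hA' := Finset.mem_filter.1 hA
      obtain ⟨p, hp⟩ := h A hA'.1 hA'.2.2 hA'.2.1
      exact ⟨p, fun _ => hp⟩
    · exact ⟨0, fun h => absurd h hA⟩
  choose g hg using h'
  refine (Finset.card_le_card_of_injOn g (fun A hA => (hg A hA).1) ?_).trans hP
  intro A hA B hB hAB
  by_contra hne
  have := hdisj (Finset.mem_filter.1 hA).1 (Finset.mem_filter.1 hB).1 hne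
  exact Set.disjoint_left.1 this (hg A hA).2 (hAB ▸ (hg B hB).2)

lemma xx_sphere {d : ℕ} (hd : 1 ≤ d) (c : Fin d → ℝ) (r δ : ℝ) (hr : 0 < r) (hδ : 0 < δ) (K : ℕ)
    (hK : 1 ≤ K) (hrK : r ≤ K * δ) :
    ∃ e : (Σ i : Fin d, Bool × ({j // j ≠ i} → Fin K)) → Fin d → ℝ,
      ∀ x ∈ frontier (cube c r), ∃ i, x ∈ cube (e i) δ := by
  haveI : Nonempty (Fin d) := ⟨⟨0, hd⟩⟩
  refine ⟨fun q j => if h : j = q.1 then c j + (if q.2.1 then r / 2 else - (r / 2)) else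
    c j - r / 2 + (((q.2.2 ⟨j, h⟩ : Fin K) : ℕ) + 1 / 2) * δ, ?_⟩
  intro x hx
  rw [xx_cube_eq, frontier_closedBall _ (by positivity), mem_sphere_iff_norm] at hx
  have hall : ∀ j, |x j - c j| ≤ r / 2 := fun j => by
    have := norm_le_pi_norm (x - c) j
    rw [hx] at this
    simpa using this
  obtain ⟨i, hi⟩ : ∃ i, |x i - c i| = r / 2 := by
    by_contra! hcon
    have : ‖x - c‖ < r / 2 := by
      rw [pi_norm_lt_iff (by positivity)]
      intro j
      simpa using lt_of_le_of_ne (hall j) (hcon j)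
    linarith
  have hg : ∀ j : {j // j ≠ i}, ∃ g : Fin K, |(x j - c j + r / 2) - ((g : ℕ) + 1 / 2) * δ| ≤ δ / 2 := by
    intro j
    have := abs_le.1 (hall j)
    exact xx_grid K hK δ _ hδ (by linarith) (by linarith)
  choose g hg using hg
  refine ⟨⟨i, decide (0 ≤ x i - c i), g⟩, ?_⟩
  rw [xx_cube_eq, Metric.mem_closedBall, dist_pi_le_iff (by positivity)]
  intro j
  rw [Real.dist_eq]
  by_cases h : j = i
  · subst h
    simp only [dite_true, decide_eq_true_eq]
    have : x j - (c j + if 0 ≤ x j - c j then r / 2 else -(r / 2)) = 0 := by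
      split_ifs with h0
      · rw [abs_of_nonneg h0] at hi; linarith
      · rw [abs_of_neg (by linarith)] at hi; linarith
    rw [this]; simp; positivity
  · simp only [h, dite_false]
    have := hg ⟨j, h⟩
    convert this using 2
    simp only
    ring

lemma xx_card {d : ℕ} (K : ℕ) :
    Fintype.card (Σ i : Fin d, Bool × ({j // j ≠ i} → Fin K)) = d * (2 * K ^ (d - 1)) := by
  simp [Fintype.card_sigma, Fintype.card_subtype_compl]

lemma xx_cover {d : ℕ} (c : Fin d → ℝ) (r : ℝ) (hr : 0 < r) :
    ∃ e : (Fin d → Fin 3) → Fin d → ℝ, ∀ x ∈ cube c (2 * r), ∃ i, x ∈ cube (e i) (2 * r / 3) := by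
  refine ⟨fun g j => c j - r + (((g j : Fin 3) : ℕ) + 1 / 2) * (2 * r / 3), ?_⟩
  intro x hx
  rw [xx_cube_eq, Metric.mem_closedBall, dist_pi_le_iff (by positivity)] at hx
  have hg : ∀ j, ∃ g : Fin 3, |(x j - c j + r) - ((g : ℕ) + 1 / 2) * (2 * r / 3)| ≤ 2 * r / 3 / 2 := by
    intro j
    have h := hx j
    rw [Real.dist_eq] at h
    have := abs_le.1 h
    exact xx_grid 3 (by norm_num) _ _ (by positivity) (by linarith) (by push_cast; linarith)
  choose g hg using hg
  refine ⟨g, ?_⟩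
  rw [xx_cube_eq, Metric.mem_closedBall, dist_pi_le_iff (by positivity)]
  intro j
  rw [Real.dist_eq]
  convert hg j using 2
  ring

lemma xx_scale {ι : Type*} {d : ℕ} (S : Finset ι) (p : ι → Fin d → ℝ)
    (hp : Set.InjOn p S) (M : ℕ) (hM : 1 ≤ M) (hS : M < S.card) :
    ∃ (c : Fin d → ℝ) (r : ℝ), 0 < r ∧ S.card ≤ M * (S.filter (fun A => p A ∈ cube c r)).card ∧
      ∀ c', M * (S.filter (fun A => p A ∈ cube c' (2 * r / 3))).card < S.card := by
  obtain ⟨R, hR, hRS⟩ : ∃ R : ℝ, 0 < R ∧ ∀ A ∈ S, p A ∈ cube 0 R := by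
    have hb : Bornology.IsBounded ((S.image p : Finset _) : Set (Fin d → ℝ)) :=
      (S.image p).finite_toSet.isBounded
    obtain ⟨R, hR, h⟩ := hb.subset_closedBall_lt 0 0
    refine ⟨2 * R, by positivity, fun A hA => ?_⟩
    rw [xx_cube_eq]
    have := h (Finset.mem_coe.2 (Finset.mem_image_of_mem p hA))
    simpa using this
  obtain ⟨η, hη, hsep⟩ : ∃ η : ℝ, 0 < η ∧ ∀ A ∈ S, ∀ B ∈ S, A ≠ B → η ≤ dist (p A) (p B) := by
    have hnt : ((S.image p : Finset _) : Set (Fin d → ℝ)).Nontrivial := by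
      rw [← Finset.Nontrivial, ← Finset.one_lt_card_iff_nontrivial, Finset.card_image_of_injOn hp]
      omega
    refine ⟨_, ((S.image p).finite_toSet.infsep_pos_iff_nontrivial).2 hnt, ?_⟩
    intro A hA B hB hne
    apply Set.infsep_le_dist_of_mem
    · exact Finset.mem_coe.2 (Finset.mem_image_of_mem p hA)
    · exact Finset.mem_coe.2 (Finset.mem_image_of_mem p hB)
    · exact fun h => hne (hp hA hB h)
  let P : ℕ → Prop := fun j => ∀ c', M * (S.filter (fun A => p A ∈ cube c' (R * (2 / 3) ^ j))).card < S.card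
  have hex : ∃ j, P j := by
    obtain ⟨j, hj⟩ := exists_pow_lt_of_lt_one (show (0 : ℝ) < η / R by positivity) (show (2 / 3 : ℝ) < 1 by norm_num)
    refine ⟨j, fun c' => ?_⟩
    have : (S.filter (fun A => p A ∈ cube c' (R * (2 / 3) ^ j))).card ≤ 1 := by
      rw [Finset.card_le_one]
      intro A hA B hB
      rw [Finset.mem_filter] at hA hB
      by_contra hne
      have h1 := hsep A hA.1 B hB.1 hne
      have h2 : dist (p A) c' ≤ _ := hA.2
      have h3 : dist (p B) c' ≤ _ := hB.2
      have h4 := dist_triangle_right (p A) (p B) c'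
      rw [lt_div_iff₀ hR] at hj
      linarith
    nlinarith
  have h0 : ¬ P 0 := by
    intro h
    have h := h 0
    rw [Finset.filter_true_of_mem (by simpa using hRS)] at h
    nlinarith
  have hpos : Nat.find hex ≠ 0 := fun h => h0 (h ▸ Nat.find_spec hex)
  obtain ⟨j, hj⟩ := Nat.exists_eq_succ_of_ne_zero hpos
  have hnot : ¬ P j := Nat.find_min hex (by omega)
  have hyes : P (j + 1) := by have := Nat.find_spec hex; rwa [hj] at this
  simp only [P, not_forall, not_lt] at hnot
  obtain ⟨c, hc⟩ := hnot
  refine ⟨c, R * (2 / 3) ^ j, by positivity, hc, fun c' => ?_⟩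
  have := hyes c'
  rwa [show R * (2 / 3 : ℝ) ^ (j + 1) = 2 * (R * (2 / 3) ^ j) / 3 by ring] at this

lemma xx_ncard {α : Type*} (S : Finset α) (q : α → Prop) :
    {A | A ∈ S ∧ q A}.ncard = (S.filter q).card := by
  rw [← Set.ncard_coe_finset]; congr 1; ext; simp

lemma xx_tiny {d : ℕ} (hd : 1 ≤ d) (S : Finset (Set (Fin d → ℝ)))
    (hobj : ∀ A ∈ S, IsObject A) (p : Fin d → ℝ) :
    ∃ (c : Fin d → ℝ) (r : ℝ), 0 < r ∧ p ∈ cube c r ∧ p ∉ interior (cube c r) ∧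
      ∀ A ∈ S, (A ∩ cube c r).Nonempty → p ∈ A := by
  haveI : Nonempty (Fin d) := ⟨⟨0, hd⟩⟩
  have hcl : IsClosed (⋃ A ∈ S.filter (fun A => p ∉ A), A) := by
    apply Set.Finite.isClosed_biUnion (Finset.finite_toSet _)
    intro A hA
    exact (hobj A (Finset.mem_filter.1 hA).1).2.1.isClosed
  have hmem : p ∈ (⋃ A ∈ S.filter (fun A => p ∉ A), A)ᶜ := by
    simp
  obtain ⟨ε, hε, hball⟩ := Metric.isOpen_iff.1 hcl.isOpen_compl p hmem
  have hdist : dist p (p + fun _ => ε / 4) = ε / 4 := by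
    rw [dist_self_add_right, pi_norm_const, Real.norm_of_nonneg (by positivity)]
  refine ⟨p + fun _ => ε / 4, ε / 2, by positivity, ?_, ?_, ?_⟩
  · rw [xx_cube_eq, Metric.mem_closedBall, hdist]; linarith
  · rw [xx_cube_eq, interior_closedBall _ (by positivity), Metric.mem_ball, hdist]; linarith
  · rintro A hA ⟨x, hxA, hx⟩
    by_contra hp
    rw [xx_cube_eq, Metric.mem_closedBall] at hx
    have h1 := dist_triangle_right x p (p + fun _ => ε / 4)
    have : x ∈ Metric.ball p ε := by rw [Metric.mem_ball]; linarith
    have := hball this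
    simp only [Set.mem_compl_iff, Set.mem_iUnion, not_exists] at this
    exact this A (Finset.mem_filter.2 ⟨hA, hp⟩) hxA

lemma xx_through {d : ℕ} {S : Finset (Set (Fin d → ℝ))}
    (hdisj : (S : Set (Set (Fin d → ℝ))).Pairwise Disjoint) (p : Fin d → ℝ) :
    (S.filter (fun A => p ∈ A)).card ≤ 1 := by
  rw [Finset.card_le_one]
  intro A hA B hB
  rw [Finset.mem_filter] at hA hB
  by_contra hne
  exact Set.disjoint_left.1 (hdisj hA.1 hB.1 hne) hA.2 hB.2

lemma xx_small {d : ℕ} {A : Set (Fin d → ℝ)} (hA : IsObject A) (δ : ℝ) (h : cubeSize A < δ)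
    (c : Fin d → ℝ) : ∃ a : ℝ, ∀ r, 0 < r → (A ∩ frontier (cube c r)).Nonempty →
      r ∈ Set.Icc a (a + 2 * δ) := by
  have hne : {r : ℝ | 0 ≤ r ∧ ∃ c : Fin d → ℝ, A ⊆ cube c r}.Nonempty := by
    obtain ⟨R, hR, h⟩ := hA.2.1.isBounded.subset_closedBall_lt 0 0
    exact ⟨2 * R, by positivity, 0, by rw [xx_cube_eq]; simpa using h⟩
  obtain ⟨ρ, ⟨_, e, he⟩, hρ⟩ := exists_lt_of_csInf_lt hne h
  refine ⟨2 * dist e c - δ, ?_⟩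
  rintro r hr ⟨x, hx, hxf⟩
  rw [xx_cube_eq, frontier_closedBall _ (by positivity), Metric.mem_sphere] at hxf
  have h1 : dist x e ≤ ρ / 2 := he hx
  have h2 := dist_triangle x e c
  have h3 := dist_triangle_left e c x
  constructor <;> linarith

end helpers

/-- Separator lemma (combinatorial content of Lemma `fatmix`): there is a hypercube
whose boundary meets few objects of `S₁ ∪ S₂` and which is balanced with respect
to `S₁`. -/
theorem exists_balanced_separator {d f : ℕ} (hd : 1 ≤ d)
    (S₁ S₂ : Finset (Set (Fin d → ℝ)))
    (hfat₁ : IsFatFam f S₁) (hfat₂ : IsFatFam f S₂)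
    (hobj₁ : ∀ A ∈ S₁, IsObject A) (hobj₂ : ∀ A ∈ S₂, IsObject A)
    (hdisj₁ : (S₁ : Set (Set (Fin d → ℝ))).Pairwise Disjoint)
    (hdisj₂ : (S₂ : Set (Set (Fin d → ℝ))).Pairwise Disjoint)
    (n : ℕ) (hn : n = S₁.card + S₂.card) (hn1 : 1 ≤ n) :
    ∃ (c : Fin d → ℝ) (r : ℝ), 0 < r ∧
      (({A : Set (Fin d → ℝ) | A ∈ S₁ ∪ S₂ ∧
          (A ∩ frontier (cube c r)).Nonempty}.ncard : ℝ)) ≤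
        ((f : ℝ) * d * 4 ^ d + 2) * (n : ℝ) ^ (1 - 1 / (d : ℝ)) ∧
      (({A : Set (Fin d → ℝ) | A ∈ S₁ ∧
          A ⊆ interior (cube c r)}.ncard : ℝ)) ≤
        ((4 ^ d - 1) / 4 ^ d) * S₁.card ∧
      (({A : Set (Fin d → ℝ) | A ∈ S₁ ∧
          Disjoint A (cube c r)}.ncard : ℝ)) ≤
        ((4 ^ d - 1) / 4 ^ d) * S₁.card := by
  have hd' : (0 : ℝ) < d := by exact_mod_cast hd
  have hn1' : (1 : ℝ) ≤ n := by exact_mod_cast hn1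
  have hobj : ∀ A ∈ S₁ ∪ S₂, IsObject A := fun A hA => by
    rcases Finset.mem_union.1 hA with h | h
    · exact hobj₁ A h
    · exact hobj₂ A h
  have h4 : (1 : ℝ) ≤ 4 ^ d := one_le_pow₀ (by norm_num)
  have hpow1 : (1 : ℝ) ≤ (n : ℝ) ^ (1 - 1 / (d : ℝ)) := by
    apply Real.one_le_rpow hn1'
    rw [sub_nonneg, div_le_one hd']
    exact_mod_cast hd
  simp only [xx_ncard]
  by_cases hcase : S₁.card ≤ 4 ^ d
  · obtain ⟨p, hp⟩ : ∃ p : Fin d → ℝ, ∀ A ∈ S₁, ∃ A ∈ S₁, p ∈ A := by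
      rcases S₁.eq_empty_or_nonempty with h | ⟨A, hA⟩
      · exact ⟨0, by simp [h]⟩
      · obtain ⟨p, hp⟩ := (hobj₁ A hA).1
        exact ⟨p, fun _ _ => ⟨A, hA, hp⟩⟩
    obtain ⟨c, r, hr, hpc, hpi, hall⟩ := xx_tiny hd (S₁ ∪ S₂) hobj p
    refine ⟨c, r, hr, ?_, ?_, ?_⟩
    · have h1 : (S₁ ∪ S₂).filter (fun A => (A ∩ frontier (cube c r)).Nonempty) ⊆
          S₁.filter (fun A => p ∈ A) ∪ S₂.filter (fun A => p ∈ A) := by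
        intro A hA
        rw [Finset.mem_filter] at hA
        rw [← Finset.filter_union, Finset.mem_filter]
        refine ⟨hA.1, hall A hA.1 (hA.2.mono ?_)⟩
        apply Set.inter_subset_inter_right
        rw [xx_cube_eq]
        exact Metric.isClosed_closedBall.frontier_subset
      have h2 := (Finset.card_le_card h1).trans (Finset.card_union_le _ _)
      have h3 := xx_through hdisj₁ p
      have h5 := xx_through hdisj₂ p
      have h6 : (((S₁ ∪ S₂).filter (fun A => (A ∩ frontier (cube c r)).Nonempty)).card : ℝ) ≤ 2 := by
        exact_mod_cast (by omega : _ ≤ 2)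
      refine h6.trans ?_
      have : (0 : ℝ) ≤ (f : ℝ) * d * 4 ^ d := by positivity
      nlinarith
    · have : S₁.filter (fun A => A ⊆ interior (cube c r)) = ∅ := by
        rw [Finset.filter_eq_empty_iff]
        intro A hA hsub
        obtain ⟨x, hx⟩ := (hobj₁ A hA).1
        exact hpi (hsub (hall A (Finset.mem_union_left _ hA) ⟨x, hx, interior_subset (hsub hx)⟩))
      rw [this]
      simp only [Finset.card_empty, Nat.cast_zero]
      have : (0 : ℝ) ≤ 4 ^ d - 1 := by linarith
      positivity
    · rcases S₁.eq_empty_or_nonempty with h | ⟨A, hA⟩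
      · simp [h]
      · obtain ⟨B, hB, hpB⟩ := hp A hA
        have hlt : (S₁.filter (fun A => Disjoint A (cube c r))).card < S₁.card := by
          apply Finset.card_lt_card
          rw [Finset.filter_ssubset]
          exact ⟨B, hB, fun hdis => Set.disjoint_left.1 hdis hpB hpc⟩
        have h1 : ((S₁.filter (fun A => Disjoint A (cube c r))).card : ℝ) + 1 ≤ S₁.card := by
          exact_mod_cast hlt
        have h2 : (S₁.card : ℝ) ≤ 4 ^ d := by exact_mod_cast hcase
        rw [div_mul_eq_mul_div, le_div_iff₀ (by positivity)]
        nlinarith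
  · push Not at hcase
    have hpt : ∀ A : Set (Fin d → ℝ), ∃ p, A ∈ S₁ → p ∈ A := fun A => by
      by_cases h : A ∈ S₁
      · obtain ⟨p, hp⟩ := (hobj₁ A h).1
        exact ⟨p, fun _ => hp⟩
      · exact ⟨0, fun h' => absurd h' h⟩
    choose p hp using hpt
    have hinj : Set.InjOn p S₁ := by
      intro A hA B hB hAB
      by_contra hne
      exact Set.disjoint_left.1 (hdisj₁ hA hB hne) (hp A hA) (hAB ▸ hp B hB)
    obtain ⟨c, r0, hr0, hmany, hfew⟩ := xx_scale S₁ p hinj (4 ^ d) (Nat.one_le_pow _ _ (by norm_num)) hcase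
    set k : ℝ := (n : ℝ) ^ (1 / (d : ℝ)) with hk
    have hk1 : 1 ≤ k := Real.one_le_rpow hn1' (by positivity)
    have hk0 : 0 < k := by linarith
    set δ : ℝ := r0 / k with hδdef
    have hδ : 0 < δ := by positivity
    have hsm : ∀ A : Set (Fin d → ℝ), ∃ a : ℝ, A ∈ (S₁ ∪ S₂).filter (fun A => cubeSize A < δ) →
        ∀ r, 0 < r → (A ∩ frontier (cube c r)).Nonempty → r ∈ Set.Icc a (a + 2 * δ) := by
      intro A
      by_cases h : A ∈ (S₁ ∪ S₂).filter (fun A => cubeSize A < δ)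
      · have h' := Finset.mem_filter.1 h
        obtain ⟨a, ha⟩ := xx_small (hobj A h'.1) δ h'.2 c
        exact ⟨a, fun _ => ha⟩
      · exact ⟨0, fun h' => absurd h' h⟩
    choose a ha using hsm
    obtain ⟨r, ⟨hr1, hr2⟩, hcount⟩ := xx_avg ((S₁ ∪ S₂).filter (fun A => cubeSize A < δ)) a (2 * δ) r0
      (by positivity) hr0
    have hr : 0 < r := by linarith
    refine ⟨c, r, hr, ?_, ?_, ?_⟩
    · set K : ℕ := ⌈2 * k⌉₊ with hKdef
      have hK1 : 2 * k ≤ K := Nat.le_ceil _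
      have hK2 : (K : ℝ) ≤ 4 * k := by
        have := Nat.ceil_lt_add_one (show 0 ≤ 2 * k by positivity)
        linarith
      have hK3 : 1 ≤ K := by
        have : (1 : ℝ) ≤ K := by linarith
        exact_mod_cast this
      have hrK : r ≤ K * δ := by
        have h1 : 2 * k * δ = 2 * r0 := by rw [hδdef]; field_simp
        have h2 : 2 * k * δ ≤ K * δ := by gcongr
        linarith
      obtain ⟨e, he⟩ := xx_sphere hd c r δ hr hδ K hK3 hrK
      have hL1 := xx_large hfat₁ hdisj₁ e δ hδ
      have hL2 := xx_large hfat₂ hdisj₂ e δ hδ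
      rw [xx_card] at hL1 hL2
      have hsub : (S₁ ∪ S₂).filter (fun A => (A ∩ frontier (cube c r)).Nonempty) ⊆
          (((S₁ ∪ S₂).filter (fun A => cubeSize A < δ)).filter
            (fun i => r ∈ Set.Icc (a i) (a i + 2 * δ))) ∪
          (S₁.filter (fun A => δ ≤ cubeSize A ∧ ∃ i, (A ∩ cube (e i) δ).Nonempty) ∪
           S₂.filter (fun A => δ ≤ cubeSize A ∧ ∃ i, (A ∩ cube (e i) δ).Nonempty)) := by
        intro A hA
        rw [Finset.mem_filter] at hA
        rw [Finset.mem_union, ← Finset.filter_union]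
        by_cases hs : cubeSize A < δ
        · left
          have hm : A ∈ (S₁ ∪ S₂).filter (fun A => cubeSize A < δ) := Finset.mem_filter.2 ⟨hA.1, hs⟩
          exact Finset.mem_filter.2 ⟨hm, ha A hm r hr hA.2⟩
        · right
          obtain ⟨x, hxA, hx⟩ := hA.2
          obtain ⟨i, hi⟩ := he x hx
          exact Finset.mem_filter.2 ⟨hA.1, not_lt.1 hs, i, x, hxA, hi⟩
      have hc := (Finset.card_le_card hsub).trans ((Finset.card_union_le _ _).trans
        (Nat.add_le_add_left (Finset.card_union_le _ _) _))
      have hc' : (((S₁ ∪ S₂).filter (fun A => (A ∩ frontier (cube c r)).Nonempty)).card : ℝ) ≤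
          ((((S₁ ∪ S₂).filter (fun A => cubeSize A < δ)).filter
            (fun i => r ∈ Set.Icc (a i) (a i + 2 * δ))).card : ℝ) +
            2 * (d * (2 * (K : ℝ) ^ (d - 1)) * f) := by
        have := hc.trans (Nat.add_le_add_left (Nat.add_le_add hL1 hL2) _)
        have h : ((_ : ℕ) : ℝ) ≤ ((_ : ℕ) : ℝ) := Nat.cast_le.2 this
        push_cast at h
        linarith
      have hTn : (((S₁ ∪ S₂).filter (fun A => cubeSize A < δ)).card : ℝ) ≤ n := by
        have := (Finset.card_filter_le (S₁ ∪ S₂) (fun A => cubeSize A < δ)).trans (Finset.card_union_le _ _)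
        rw [← hn] at this
        exact_mod_cast this
      have hkpow : k ^ (d - 1) = (n : ℝ) ^ (1 - 1 / (d : ℝ)) := by
        rw [hk, ← Real.rpow_natCast, ← Real.rpow_mul (by positivity)]
        congr 1
        push_cast [hd]
        field_simp
      have hkdiv : (n : ℝ) / k = (n : ℝ) ^ (1 - 1 / (d : ℝ)) := by
        rw [Real.rpow_sub (by linarith), Real.rpow_one]
      have hsmall : (((S₁ ∪ S₂).filter (fun A => cubeSize A < δ)).card : ℝ) * (2 * δ) / r0 ≤
          2 * (n : ℝ) ^ (1 - 1 / (d : ℝ)) := by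
        have h1 : (((S₁ ∪ S₂).filter (fun A => cubeSize A < δ)).card : ℝ) * (2 * δ) / r0 ≤
          n * (2 * δ) / r0 := by gcongr
        have h2 : (n : ℝ) * (2 * δ) / r0 = 2 * (n / k) := by rw [hδdef]; field_simp
        rw [h2, hkdiv] at h1
        exact h1
      have hKp : (K : ℝ) ^ (d - 1) ≤ 4 ^ (d - 1) * (n : ℝ) ^ (1 - 1 / (d : ℝ)) := by
        rw [← hkpow, ← mul_pow]
        gcongr
      have hbig : 2 * (d * (2 * (K : ℝ) ^ (d - 1)) * f) ≤
          (f : ℝ) * d * 4 ^ d * (n : ℝ) ^ (1 - 1 / (d : ℝ)) := by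
        have h44 : (4 : ℝ) ^ d = 4 ^ (d - 1) * 4 := by
          rw [← pow_succ]; congr 1; omega
        calc 2 * (d * (2 * (K : ℝ) ^ (d - 1)) * f)
            ≤ 2 * (d * (2 * (4 ^ (d - 1) * (n : ℝ) ^ (1 - 1 / (d : ℝ)))) * f) := by gcongr
          _ = _ := by rw [h44]; ring
      linarith
    · obtain ⟨e, he⟩ := xx_cover c r0 hr0
      have hsub : S₁.filter (fun A => A ⊆ interior (cube c r)) ⊆
          Finset.univ.biUnion (fun g => S₁.filter (fun A => p A ∈ cube (e g) (2 * r0 / 3))) := by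
        intro A hA
        rw [Finset.mem_filter] at hA
        have h0 : p A ∈ cube c r := interior_subset (hA.2 (hp A hA.1))
        have h1 : dist (p A) c ≤ r / 2 := h0
        have h2 : p A ∈ cube c (2 * r0) := by
          rw [xx_cube_eq, Metric.mem_closedBall]; linarith
        obtain ⟨g, hg⟩ := he _ h2
        exact Finset.mem_biUnion.2 ⟨g, Finset.mem_univ _, Finset.mem_filter.2 ⟨hA.1, hg⟩⟩
      have h1 := (Finset.card_le_card hsub).trans Finset.card_biUnion_le
      have h2 : 4 ^ d * (S₁.filter (fun A => A ⊆ interior (cube c r))).card ≤ 3 ^ d * S₁.card := by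
        calc _ ≤ 4 ^ d * ∑ g, (S₁.filter (fun A => p A ∈ cube (e g) (2 * r0 / 3))).card :=
              Nat.mul_le_mul_left _ h1
          _ = ∑ g, 4 ^ d * (S₁.filter (fun A => p A ∈ cube (e g) (2 * r0 / 3))).card := Finset.mul_sum _ _ _
          _ ≤ ∑ g : Fin d → Fin 3, S₁.card := Finset.sum_le_sum fun g _ => (hfew (e g)).le
          _ = _ := by simp
      have h3 : (3 : ℕ) ^ d + 1 ≤ 4 ^ d := Nat.pow_lt_pow_left (by norm_num) (by omega)
      have h2' : (4 : ℝ) ^ d * (S₁.filter (fun A => A ⊆ interior (cube c r))).card ≤ 3 ^ d * S₁.card := by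
        exact_mod_cast h2
      have h3' : (3 : ℝ) ^ d + 1 ≤ 4 ^ d := by exact_mod_cast h3
      rw [div_mul_eq_mul_div, le_div_iff₀ (by positivity)]
      have h5 : (0 : ℝ) ≤ S₁.card := by positivity
      nlinarith
    · have hsplit := Finset.card_filter_add_card_filter_not (s := S₁) (fun A => p A ∈ cube c r0)
      have hle : (S₁.filter (fun A => Disjoint A (cube c r))).card ≤
          (S₁.filter (fun A => ¬ p A ∈ cube c r0)).card := by
        apply Finset.card_le_card
        intro A hA
        rw [Finset.mem_filter] at hA ⊢
        refine ⟨hA.1, fun h => Set.disjoint_left.1 hA.2 (hp A hA.1) ?_⟩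
        have h : dist (p A) c ≤ r0 / 2 := h
        rw [xx_cube_eq, Metric.mem_closedBall]; linarith
      have h1 : (S₁.card : ℝ) ≤ 4 ^ d * (S₁.filter (fun A => p A ∈ cube c r0)).card := by
        exact_mod_cast hmany
      have h2 : ((S₁.filter (fun A => p A ∈ cube c r0)).card : ℝ) +
          (S₁.filter (fun A => Disjoint A (cube c r))).card ≤ S₁.card := by
        exact_mod_cast (by omega : _ ≤ S₁.card)
      rw [div_mul_eq_mul_div, le_div_iff₀ (by positivity)]
      nlinarith
end

section
/- For every dimension d ≥ 1 and every f ∈ ℕ there is a constant C > 0 (depending only on d and f) with the following property. Let S₁ and S₂ be finite f-fat families of objects in ℝ^d, each pairwise disjoint, and set n = |S₁| + |S₂| with n ≥ 2. Then there exist m ≤ n and a sequence J₀, J₁, …, J_m of subfamilies of S₁ ∪ S₂ such that J₀ = S₁, J_m = S₂, every J_i is pairwise disjoint, consecutive families differ in exactly one member (|J_i Δ J_{i+1}| = 1 for all i < m), and |J_i| ≥ min(|S₁|, |S₂|) − C·n^{1 − 1/d}·log n for every i. -/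
open scoped Classical

namespace FatMix

/-- Enumerate a finset in order of increasing key. -/
lemma exists_enum {α : Type*} (κ : α → ℕ) (D : Finset α) :
    ∃ E : ℕ → Finset α, E 0 = ∅ ∧ E D.card = D ∧ (∀ i ≤ D.card, E i ⊆ D) ∧
      (∀ i < D.card, ∃ x, x ∉ E i ∧ E (i+1) = insert x (E i)) ∧
      (∀ i ≤ D.card, ∀ x ∈ E i, ∀ y ∈ D, κ y < κ x → y ∈ E i) := by
  induction' hn : D.card with n ih generalizing D
  · have : D = ∅ := Finset.card_eq_zero.mp hn
    subst this
    exact ⟨fun _ => ∅, by simp⟩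
  · have hne : D.Nonempty := by rw [← Finset.card_pos]; omega
    obtain ⟨x, hx, hmax⟩ := D.exists_max_image κ hne
    have hc : (D.erase x).card = n := by rw [Finset.card_erase_of_mem hx]; omega
    obtain ⟨E, h0, h1, h2, h3, h4⟩ := ih (D.erase x) hc
    refine ⟨fun i => if i ≤ n then E i else D, by simp [h0], by simp, ?_, ?_, ?_⟩
    · intro i hi
      dsimp only
      split_ifs with h
      · exact (h2 i h).trans (Finset.erase_subset _ _)
      · exact subset_rfl
    · intro i hi
      rcases Nat.lt_or_ge i n with h | h
      · obtain ⟨y, hy⟩ := h3 i h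
        refine ⟨y, ?_⟩
        simpa [h.le, Nat.succ_le_of_lt h] using hy
      · have : i = n := by omega
        subst this
        refine ⟨x, ?_⟩
        simp [h1, Finset.insert_erase hx]
    · intro i hi y hy z hz hlt
      dsimp only at hy ⊢
      split_ifs with h
      · rw [if_pos h] at hy
        have hyD := h2 i h hy
        refine h4 i h y hy z ?_ hlt
        refine Finset.mem_erase.mpr ⟨?_, hz⟩
        rintro rfl
        have := hmax y (Finset.mem_of_mem_erase hyD)
        omega
      · exact hz

section mix
variable {α : Type*} (S₁ S₂ : Finset α) (R : α → α → Prop)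

lemma mix_of_pd (T : ℕ) (l r : α → ℕ) (w : ℕ)
    (hlr : ∀ v ∈ S₁ ∪ S₂, l v ≤ r v ∧ r v ≤ T)
    (hR1 : ∀ u ∈ S₁, ∀ v ∈ S₁, u ≠ v → R u v) (hR2 : ∀ u ∈ S₂, ∀ v ∈ S₂, u ≠ v → R u v)
    (hsymm : ∀ u v, R u v → R v u)
    (hadj : ∀ u ∈ S₁ ∪ S₂, ∀ v ∈ S₁ ∪ S₂, ¬ R u v → l u ≤ r v)
    (hbag : ∀ t, ((S₁ ∪ S₂).filter (fun v => l v ≤ t ∧ t ≤ r v)).card ≤ w) :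
    ∃ (m : ℕ) (J : ℕ → Finset α), m ≤ S₁.card + S₂.card ∧ J 0 = S₁ ∧ J m = S₂ ∧
      (∀ i ≤ m, J i ⊆ S₁ ∪ S₂) ∧
      (∀ i ≤ m, ∀ u ∈ J i, ∀ v ∈ J i, u ≠ v → R u v) ∧
      (∀ i < m, (symmDiff (J i) (J (i + 1))).card = 1) ∧
      (∀ i ≤ m, min S₁.card S₂.card ≤ (J i).card + 2 * w) := by
  set D1 := S₁ \ S₂ with hD1
  set D2 := S₂ \ S₁ with hD2
  have hdisj : Disjoint D1 D2 := by
    rw [Finset.disjoint_left]; intro a; simp [hD1, hD2]; tauto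
  -- starting time
  obtain ⟨t0, ht0, hmin⟩ := (Finset.range (T+1)).exists_min_image
    (fun t => ((D2.filter (fun b => l b ≤ t)).card : ℤ) - (D1.filter (fun a => l a ≤ t)).card)
    ⟨0, by simp⟩
  simp only [Finset.mem_range] at ht0 hmin
  let τ1 : α → ℕ := fun a => if t0 < l a then l a else if t0 ≤ r a then 0 else T + 1 + l a
  let τ2 : α → ℕ := fun b => if t0 < l b then r b else if t0 ≤ r b then 2 * T + 2 else T + 1 + r b
  let κ : α → ℕ := fun v => if v ∈ S₁ then 2 * τ1 v else 2 * τ2 v + 1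
  obtain ⟨E, hE0, hE1, hEs, hEi, hEκ⟩ := exists_enum κ (D1 ∪ D2)
  have hJ : ∀ i ≤ (D1 ∪ D2).card, symmDiff S₁ (E i) = (S₁ \ (E i ∩ D1)) ∪ (E i ∩ D2) := by
    intro i hi
    ext v
    have := @hEs i hi v
    simp only [Finset.mem_symmDiff, Finset.mem_union, Finset.mem_sdiff, Finset.mem_inter, hD1, hD2] at this ⊢
    tauto
  have hS1 : (S₁ ∩ S₂).card + D1.card = S₁.card := Finset.card_inter_add_card_sdiff S₁ S₂
  have hS2 : (S₁ ∩ S₂).card + D2.card = S₂.card := by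
    rw [Finset.inter_comm]; exact Finset.card_inter_add_card_sdiff S₂ S₁
  have hcardD : (D1 ∪ D2).card = D1.card + D2.card := Finset.card_union_of_disjoint hdisj
  -- counting
  have hb1 : ∀ t, (D1.filter (fun v => l v ≤ t ∧ t ≤ r v)).card ≤ w := fun t =>
    (Finset.card_le_card (Finset.filter_subset_filter _ (by
      intro v; simp [hD1]; tauto))).trans (hbag t)
  have hb2 : ∀ t, (D2.filter (fun v => l v ≤ t ∧ t ≤ r v)).card ≤ w := fun t =>
    (Finset.card_le_card (Finset.filter_subset_filter _ (by
      intro v; simp [hD2]; tauto))).trans (hbag t)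
  have hl1 : ∀ a ∈ D1, l a ≤ r a ∧ r a ≤ T := fun a ha => hlr a (by
    simp [hD1] at ha; simp [ha.1])
  have hl2 : ∀ a ∈ D2, l a ≤ r a ∧ r a ≤ T := fun a ha => hlr a (by
    simp [hD2] at ha; simp [ha.1])
  have hcount : ∀ τ, ((D1.filter (fun a => τ1 a ≤ τ)).card : ℤ) ≤
      (D2.filter (fun b => τ2 b < τ)).card + max 0 ((D1.card : ℤ) - D2.card) + 2 * w := by
    intro τ
    have hb1' := hb1 t0
    rcases Nat.lt_or_ge T τ with hτ | hτ
    · -- wrapped phase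
      set u := min (τ - (T + 1)) t0 with hu
      have h1 : (D1.filter (fun a => τ1 a ≤ τ)).card + (D1.filter (fun a => l a ≤ t0)).card ≤
          D1.card + (D1.filter (fun v => l v ≤ t0 ∧ t0 ≤ r v)).card + (D1.filter (fun a => l a ≤ u)).card := by
        have e1 : D1.filter (fun a => τ1 a ≤ τ) ⊆ (D1.filter (fun a => ¬ l a ≤ t0)) ∪
            (D1.filter (fun v => l v ≤ t0 ∧ t0 ≤ r v)) ∪ (D1.filter (fun a => l a ≤ u)) := by
          intro a ha
          simp only [Finset.mem_filter, Finset.mem_union] at ha ⊢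
          have := hl1 a ha.1
          obtain ⟨h, h'⟩ := ha
          simp only [τ1] at h'
          split_ifs at h' <;> simp only [h, true_and] <;> omega
        have e2 := (Finset.card_le_card e1).trans ((Finset.card_union_le _ _).trans
          (Nat.add_le_add_right (Finset.card_union_le _ _) _))
        have e3 := Finset.card_filter_add_card_filter_not (s := D1) (fun a => l a ≤ t0)
        omega
      have h2 : D2.card + (D2.filter (fun b => l b ≤ u)).card ≤ (D2.filter (fun b => τ2 b < τ)).card
          + (D2.filter (fun v => l v ≤ u ∧ u ≤ r v)).card + (D2.filter (fun b => l b ≤ t0)).card := by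
        have e1 : (D2.filter (fun b => ¬ l b ≤ t0)) ∪ (D2.filter (fun b => l b ≤ u)) ⊆
            (D2.filter (fun b => τ2 b < τ)) ∪ (D2.filter (fun v => l v ≤ u ∧ u ≤ r v)) := by
          intro a ha
          simp only [Finset.mem_filter, Finset.mem_union] at ha ⊢
          have hD : a ∈ D2 := by tauto
          have := hl2 a hD
          simp only [hD, true_and, τ2] at ha ⊢
          split_ifs <;> omega
        have e2 := (Finset.card_le_card e1).trans (Finset.card_union_le _ _)
        rw [Finset.card_union_of_disjoint (by
          rw [Finset.disjoint_left]; intro a; simp only [Finset.mem_filter]; omega)] at e2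
        have e3 := Finset.card_filter_add_card_filter_not (s := D2) (fun a => l a ≤ t0)
        omega
      have h3 := hmin u (by omega)
      have h4 := hb2 u
      have h5 := le_max_right 0 ((D1.card : ℤ) - D2.card)
      omega
    · have h5 := le_max_left 0 ((D1.card : ℤ) - D2.card)
      rcases Nat.lt_or_ge t0 τ with hτ0 | hτ0
      · have h1 : (D1.filter (fun a => τ1 a ≤ τ)).card + (D1.filter (fun a => l a ≤ t0)).card ≤
          (D1.filter (fun v => l v ≤ t0 ∧ t0 ≤ r v)).card + (D1.filter (fun a => l a ≤ τ)).card := by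
          have e0 := Finset.card_union_add_card_inter (D1.filter (fun a => τ1 a ≤ τ))
            (D1.filter (fun a => l a ≤ t0))
          have e1 : (D1.filter (fun a => τ1 a ≤ τ)) ∪ (D1.filter (fun a => l a ≤ t0)) ⊆
              D1.filter (fun a => l a ≤ τ) := by
            intro a ha
            simp only [Finset.mem_filter, Finset.mem_union] at ha ⊢
            have hD : a ∈ D1 := by tauto
            have := hl1 a hD
            simp only [hD, true_and, τ1] at ha ⊢
            split_ifs at ha <;> omega
          have e2 : (D1.filter (fun a => τ1 a ≤ τ)) ∩ (D1.filter (fun a => l a ≤ t0)) ⊆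
              D1.filter (fun v => l v ≤ t0 ∧ t0 ≤ r v) := by
            intro a ha
            simp only [Finset.mem_filter, Finset.mem_inter] at ha ⊢
            obtain ⟨⟨h, h'⟩, -, h''⟩ := ha
            simp only [τ1] at h'
            have := hl1 a h
            split_ifs at h' <;> simp only [h, true_and] <;> omega
          have := Finset.card_le_card e1
          have := Finset.card_le_card e2
          omega
        have h2 : (D2.filter (fun b => l b ≤ τ)).card ≤ (D2.filter (fun b => τ2 b < τ)).card
          + (D2.filter (fun v => l v ≤ τ ∧ τ ≤ r v)).card + (D2.filter (fun b => l b ≤ t0)).card := by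
          have e1 : (D2.filter (fun b => l b ≤ τ)) ⊆ (D2.filter (fun b => τ2 b < τ)) ∪
              (D2.filter (fun v => l v ≤ τ ∧ τ ≤ r v)) ∪ (D2.filter (fun b => l b ≤ t0)) := by
            intro a ha
            simp only [Finset.mem_filter, Finset.mem_union] at ha ⊢
            have hD : a ∈ D2 := by tauto
            have := hl2 a hD
            simp only [hD, true_and, τ2] at ha ⊢
            split_ifs <;> omega
          have := (Finset.card_le_card e1).trans ((Finset.card_union_le _ _).trans
            (Nat.add_le_add_right (Finset.card_union_le _ _) _))
          omega
        have h3 := hmin τ (by omega)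
        have h4 := hb2 τ
        omega
      · have h1 : (D1.filter (fun a => τ1 a ≤ τ)).card ≤
          (D1.filter (fun v => l v ≤ t0 ∧ t0 ≤ r v)).card := by
          apply Finset.card_le_card
          intro a ha
          simp only [Finset.mem_filter] at ha ⊢
          obtain ⟨h, h'⟩ := ha
          simp only [τ1] at h'
          have := hl1 a h
          split_ifs at h' <;> simp only [h, true_and] <;> omega
        omega
  have hκ1 : ∀ a ∈ D1, κ a = 2 * τ1 a := by
    intro a ha; simp [hD1] at ha; simp [κ, ha.1]
  have hκ2 : ∀ a ∈ D2, κ a = 2 * τ2 a + 1 := by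
    intro a ha; simp [hD2] at ha; simp [κ, ha.2]
  have key : ∀ i ≤ (D1 ∪ D2).card, ((E i ∩ D1).card : ℤ) ≤
      (E i ∩ D2).card + max 0 ((D1.card : ℤ) - D2.card) + 2 * w := by
    intro i hi
    rcases (E i).eq_empty_or_nonempty with h | h
    · simp [h]; positivity
    · obtain ⟨x, hx, hmax⟩ := (E i).exists_max_image κ h
      have hc := hcount (κ x / 2)
      have h1 : (E i ∩ D1).card ≤ (D1.filter (fun a => τ1 a ≤ κ x / 2)).card := by
        apply Finset.card_le_card
        intro a ha
        simp only [Finset.mem_inter, Finset.mem_filter] at ha ⊢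
        refine ⟨ha.2, ?_⟩
        have := hmax a ha.1
        rw [hκ1 a ha.2] at this
        omega
      have h2 : (D2.filter (fun b => τ2 b < κ x / 2)).card ≤ (E i ∩ D2).card := by
        apply Finset.card_le_card
        intro a ha
        simp only [Finset.mem_inter, Finset.mem_filter] at ha ⊢
        refine ⟨hEκ i hi x hx a (Finset.mem_union_right _ ha.1) ?_, ha.1⟩
        rw [hκ2 a ha.1]
        omega
      omega
  refine ⟨(D1 ∪ D2).card, fun i => symmDiff S₁ (E i), by omega, ?_, ?_, ?_, ?_, ?_, ?_⟩
  · simp [hE0]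
  · simp only [hE1]
    ext v
    simp only [Finset.mem_symmDiff, Finset.mem_union, Finset.mem_sdiff, hD1, hD2]
    tauto
  · intro i hi v hv
    have := @hEs i hi v
    simp only [Finset.mem_symmDiff, Finset.mem_union, Finset.mem_sdiff, hD1, hD2] at this hv ⊢
    tauto
  · intro i hi
    have cross : ∀ u ∈ S₁ \ (E i ∩ D1), ∀ v ∈ E i ∩ D2, R u v := by
      intro u hu v hv
      simp only [Finset.mem_sdiff, Finset.mem_inter] at hu hv
      by_cases hu2 : u ∈ S₂
      · refine hR2 u hu2 v (Finset.mem_sdiff.mp hv.2).1 ?_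
        rintro rfl
        exact (Finset.mem_sdiff.mp hv.2).2 hu.1
      · have huD : u ∈ D1 := Finset.mem_sdiff.mpr ⟨hu.1, hu2⟩
        by_contra hcon
        apply hu.2
        refine ⟨hEκ i hi v hv.1 u (Finset.mem_union_left _ huD) ?_, huD⟩
        rw [hκ1 u huD, hκ2 v hv.2]
        have hu' : u ∈ S₁ ∪ S₂ := Finset.mem_union_left _ hu.1
        have hv' : v ∈ S₁ ∪ S₂ := Finset.mem_union_right _ (Finset.mem_sdiff.mp hv.2).1
        have a1 := hadj u hu' v hv' hcon
        have a2 := hadj v hv' u hu' (fun h => hcon (hsymm _ _ h))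
        have a3 := hlr u hu'
        have a4 := hlr v hv'
        simp only [τ1, τ2]
        split_ifs <;> omega
    intro u hu v hv huv
    simp only [hJ i hi, Finset.mem_union] at hu hv
    rcases hu with hu | hu <;> rcases hv with hv | hv
    · exact hR1 u (Finset.mem_sdiff.mp hu).1 v (Finset.mem_sdiff.mp hv).1 huv
    · exact cross u hu v hv
    · exact hsymm _ _ (cross v hv u hu)
    · simp only [Finset.mem_inter, hD2, Finset.mem_sdiff] at hu hv
      exact hR2 u hu.2.1 v hv.2.1 huv
  · intro i hi
    obtain ⟨x, hx, hxE⟩ := hEi i hi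
    have : symmDiff (symmDiff S₁ (E i)) (symmDiff S₁ (E (i+1))) = {x} := by
      rw [hxE]
      ext v
      by_cases hv : v = x
      · subst hv
        simp only [Finset.mem_symmDiff, Finset.mem_insert, Finset.mem_singleton]
        tauto
      · simp only [Finset.mem_symmDiff, Finset.mem_insert, Finset.mem_singleton, hv, false_or]
        tauto
    simp only [this, Finset.card_singleton]
  · intro i hi
    simp only [hJ i hi]
    rw [Finset.card_union_of_disjoint (by
      rw [Finset.disjoint_left]; intro a; simp only [Finset.mem_sdiff, Finset.mem_inter, hD2]; tauto)]
    have h1 : (S₁ \ (E i ∩ D1)).card + (E i ∩ D1).card = S₁.card :=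
      Finset.card_sdiff_add_card_eq_card (by intro a; simp [hD1]; tauto)
    have := key i hi
    omega

end mix

def HasPD {X : Type*} (V : Finset (Set X)) (w : ℝ) : Prop :=
  ∃ (T : ℕ) (l r : Set X → ℕ), (∀ v ∈ V, l v ≤ r v ∧ r v ≤ T) ∧
    (∀ u ∈ V, ∀ v ∈ V, ¬ Disjoint u v → l u ≤ r v) ∧
    ∀ t, ((V.filter (fun v => l v ≤ t ∧ t ≤ r v)).card : ℝ) ≤ w

lemma hasPD_triv {X : Type*} (V : Finset (Set X)) (w : ℝ) (h : (V.card : ℝ) ≤ w) : HasPD V w :=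
  ⟨0, fun _ => 0, fun _ => 0, by simp, by simp, fun t =>
    le_trans (by exact_mod_cast Finset.card_le_card (Finset.filter_subset _ _)) h⟩

lemma hasPD_join {X : Type*} (V A B Y : Finset (Set X)) (w x : ℝ)
    (hA : HasPD A w) (hB : HasPD B w) (hY : (Y.card : ℝ) ≤ x) (hV : V ⊆ A ∪ B ∪ Y)
    (hAB : ∀ a ∈ A, ∀ b ∈ B, Disjoint a b) : HasPD V (w + x) := by
  obtain ⟨T1, l1, r1, h1, h1', h1''⟩ := hA
  obtain ⟨T2, l2, r2, h2, h2', h2''⟩ := hB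
  refine ⟨T1 + T2 + 1,
    fun v => if v ∈ Y then 0 else if v ∈ A then l1 v else T1 + 1 + l2 v,
    fun v => if v ∈ Y then T1 + T2 + 1 else if v ∈ A then r1 v else T1 + 1 + r2 v, ?_, ?_, ?_⟩
  · intro v hv
    dsimp only
    have := hV hv
    simp only [Finset.mem_union] at this
    split_ifs with hy ha
    · simp
    · have := h1 v ha; omega
    · have := h2 v (by tauto); omega
  · intro u hu v hv huv
    dsimp only
    have hu' := hV hu
    have hv' := hV hv
    simp only [Finset.mem_union] at hu' hv'
    by_cases huY : u ∈ Y
    · simp [huY]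
    by_cases hvY : v ∈ Y
    · simp only [huY, hvY, if_true, if_false]
      split_ifs with ha
      · have := h1 u ha; omega
      · have := h2 u (by tauto); omega
    simp only [huY, hvY, if_false]
    split_ifs with ha hb hb
    · exact h1' u ha v hb huv
    · exact absurd (hAB u ha v (by tauto)) huv
    · exact absurd (hAB v hb u (by tauto)).symm huv
    · have := h2' u (by tauto) v (by tauto) huv
      omega
  · intro t
    rcases Nat.lt_or_ge T1 t with ht | ht
    · have e : (V.filter (fun v => (if v ∈ Y then 0 else if v ∈ A then l1 v else T1 + 1 + l2 v) ≤ t ∧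
          t ≤ (if v ∈ Y then T1 + T2 + 1 else if v ∈ A then r1 v else T1 + 1 + r2 v))) ⊆
          (B.filter (fun v => l2 v ≤ t - (T1 + 1) ∧ t - (T1 + 1) ≤ r2 v)) ∪ Y := by
        intro v hv
        simp only [Finset.mem_union, Finset.mem_filter] at hv ⊢
        obtain ⟨hv, hv1⟩ := hv
        have hv' := hV hv
        simp only [Finset.mem_union] at hv'
        by_cases hy : v ∈ Y
        · exact Or.inr hy
        · left
          simp only [hy, if_false] at hv1
          by_cases ha : v ∈ A
          · have := h1 v ha
            simp only [ha, if_true] at hv1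
            omega
          · simp only [ha, if_false] at hv1
            exact ⟨by tauto, by omega, by omega⟩
      have e2 : ((V.filter (fun v => (if v ∈ Y then 0 else if v ∈ A then l1 v else T1 + 1 + l2 v) ≤ t ∧
          t ≤ (if v ∈ Y then T1 + T2 + 1 else if v ∈ A then r1 v else T1 + 1 + r2 v))).card : ℝ) ≤
          ((B.filter (fun v => l2 v ≤ t - (T1 + 1) ∧ t - (T1 + 1) ≤ r2 v)).card : ℝ) + Y.card := by
        exact_mod_cast (Finset.card_le_card e).trans (Finset.card_union_le _ _)
      exact e2.trans (add_le_add (h2'' _) hY)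
    · have e : (V.filter (fun v => (if v ∈ Y then 0 else if v ∈ A then l1 v else T1 + 1 + l2 v) ≤ t ∧
          t ≤ (if v ∈ Y then T1 + T2 + 1 else if v ∈ A then r1 v else T1 + 1 + r2 v))) ⊆
          (A.filter (fun v => l1 v ≤ t ∧ t ≤ r1 v)) ∪ Y := by
        intro v hv
        simp only [Finset.mem_union, Finset.mem_filter] at hv ⊢
        obtain ⟨hv, hv1⟩ := hv
        by_cases hy : v ∈ Y
        · exact Or.inr hy
        · left
          simp only [hy, if_false] at hv1
          by_cases ha : v ∈ A
          · simp only [ha, if_true] at hv1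
            exact ⟨ha, hv1⟩
          · simp only [ha, if_false] at hv1
            omega
      have e2 : ((V.filter (fun v => (if v ∈ Y then 0 else if v ∈ A then l1 v else T1 + 1 + l2 v) ≤ t ∧
          t ≤ (if v ∈ Y then T1 + T2 + 1 else if v ∈ A then r1 v else T1 + 1 + r2 v))).card : ℝ) ≤
          ((A.filter (fun v => l1 v ≤ t ∧ t ≤ r1 v)).card : ℝ) + Y.card := by
        exact_mod_cast (Finset.card_le_card e).trans (Finset.card_union_le _ _)
      exact e2.trans (add_le_add (h1'' _) hY)

/-- Low density families. -/
def Good {d : ℕ} (ρ : ℕ) (V : Finset (Set (Fin d → ℝ))) : Prop :=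
  (∀ A ∈ V, IsObject A) ∧ (∀ x, (V.filter (fun A => x ∈ A)).card ≤ 2) ∧
  ∀ (c : Fin d → ℝ) (r : ℝ), 0 < r →
    (V.filter (fun A => (A ∩ cube c r).Nonempty ∧ r ≤ cubeSize A)).card ≤ ρ

lemma Good.mono {d ρ : ℕ} {V W : Finset (Set (Fin d → ℝ))} (h : Good ρ V) (hW : W ⊆ V) :
    Good ρ W :=
  ⟨fun A hA => h.1 A (hW hA),
   fun x => (Finset.card_le_card (Finset.filter_subset_filter _ hW)).trans (h.2.1 x),
   fun c r hr => (Finset.card_le_card (Finset.filter_subset_filter _ hW)).trans (h.2.2 c r hr)⟩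

/-- Given a separator theorem, path decompositions. -/
lemma pd_of_sep {d : ℕ} (hd : 1 ≤ d) (ρ : ℕ) (B K q : ℝ) (hB : 0 ≤ B) (hK : 0 ≤ K)
    (hq : 0 < q)
    (hsep : ∀ V : Finset (Set (Fin d → ℝ)), Good ρ V → B < V.card →
      ∃ I O Y : Finset (Set (Fin d → ℝ)), I ⊆ V ∧ O ⊆ V ∧ V ⊆ I ∪ O ∪ Y ∧
        (∀ a ∈ I, ∀ b ∈ O, Disjoint a b) ∧
        (I.card : ℝ) ≤ q * V.card ∧ (O.card : ℝ) ≤ q * V.card ∧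
        (Y.card : ℝ) ≤ K * (V.card : ℝ) ^ (1 - 1 / (d : ℝ)))
    (n : ℕ) (hn : 1 ≤ n) (L : ℕ) :
    ∀ V : Finset (Set (Fin d → ℝ)), Good ρ V → V.card ≤ n → (V.card : ℝ) * q ^ L ≤ B →
      HasPD V ((B + L * K) * (n : ℝ) ^ (1 - 1 / (d : ℝ))) := by
  have hexp : (0:ℝ) ≤ 1 - 1 / (d : ℝ) := by
    have : (1:ℝ) ≤ d := by exact_mod_cast hd
    rw [sub_nonneg, div_le_one (by linarith)]; exact this
  have hn' : (1:ℝ) ≤ n := by exact_mod_cast hn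
  have hM : (1:ℝ) ≤ (n : ℝ) ^ (1 - 1 / (d : ℝ)) := Real.one_le_rpow hn' hexp
  have triv : ∀ (L : ℕ) (V : Finset (Set (Fin d → ℝ))), (V.card : ℝ) ≤ B →
      HasPD V ((B + L * K) * (n : ℝ) ^ (1 - 1 / (d : ℝ))) := by
    intro L V hV
    apply hasPD_triv
    have h0 : 0 ≤ L * K := by positivity
    nlinarith
  induction L with
  | zero => intro V _ _ h; exact triv 0 V (by simpa using h)
  | succ L ih =>
    intro V hV hc h
    by_cases hVB : (V.card : ℝ) ≤ B
    · exact triv _ V hVB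
    · obtain ⟨I, O, Y, hI, hO, hcov, hdis, hIc, hOc, hYc⟩ := hsep V hV (by linarith)
      have hp : 0 < q ^ L := pow_pos hq L
      have main : ∀ W ⊆ V, (W.card : ℝ) ≤ q * V.card →
          HasPD W ((B + L * K) * (n : ℝ) ^ (1 - 1 / (d : ℝ))) := by
        intro W hW hWc
        refine ih W (hV.mono hW) ((Finset.card_le_card hW).trans hc) ?_
        refine le_trans (mul_le_mul_of_nonneg_right hWc hp.le) ?_
        calc q * V.card * q ^ L = V.card * q ^ (L+1) := by ring
          _ ≤ B := h
      have hY' : (Y.card : ℝ) ≤ K * (n : ℝ) ^ (1 - 1 / (d : ℝ)) := by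
        refine hYc.trans (mul_le_mul_of_nonneg_left ?_ hK)
        exact Real.rpow_le_rpow (by positivity) (by exact_mod_cast hc) hexp
      have := hasPD_join V I O Y _ _ (main I hI hIc) (main O hO hOc) hY' hcov hdis
      convert this using 1
      push_cast; ring

/-- A cluster point. -/
lemma exists_cluster {α X : Type*} [PseudoMetricSpace X] (V : Finset α) (x : α → X) (k : ℕ)
    (hk : 0 < k) (hkV : k ≤ V.card) :
    ∃ A ∈ V, ∃ r : ℝ, 0 ≤ r ∧ k ≤ (V.filter (fun C => dist (x C) (x A) ≤ r)).card ∧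
      ∀ F ⊆ V, ∀ s < r, (∀ a ∈ F, ∀ b ∈ F, dist (x a) (x b) ≤ s) → F.card < k := by
  have hne : V.Nonempty := Finset.card_pos.mp (by omega)
  let Q := (V ×ˢ V).filter (fun p => k ≤ (V.filter (fun C => dist (x C) (x p.1) ≤ dist (x p.2) (x p.1))).card)
  have hQ : Q.Nonempty := by
    obtain ⟨a, ha⟩ := hne
    obtain ⟨b, hb, hmax⟩ := V.exists_max_image (fun b => dist (x b) (x a)) ⟨a, ha⟩
    refine ⟨(a, b), ?_⟩
    simp only [Q, Finset.mem_filter, Finset.mem_product]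
    refine ⟨⟨ha, hb⟩, ?_⟩
    rwa [Finset.filter_true_of_mem hmax]
  obtain ⟨⟨a, b⟩, hab, hmin⟩ := Q.exists_min_image (fun p => dist (x p.2) (x p.1)) hQ
  have hab' := hab
  simp only [Q, Finset.mem_filter, Finset.mem_product] at hab'
  refine ⟨a, hab'.1.1, dist (x b) (x a), dist_nonneg, hab'.2, ?_⟩
  intro F hF s hs hFs
  by_contra hcon
  push Not at hcon
  obtain ⟨c, hc⟩ : F.Nonempty := Finset.card_pos.mp (by omega)
  obtain ⟨e, he, hmax⟩ := F.exists_max_image (fun b => dist (x b) (x c)) ⟨c, hc⟩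
  have : (c, e) ∈ Q := by
    simp only [Q, Finset.mem_filter, Finset.mem_product]
    refine ⟨⟨hF hc, hF he⟩, hcon.trans (Finset.card_le_card ?_)⟩
    intro g hg
    exact Finset.mem_filter.mpr ⟨hF hg, hmax g hg⟩
  have h1 := hmin _ this
  have h2 := hFs e he c hc
  dsimp only at h1
  linarith

lemma dist_lt_of_cubeSize_lt {d : ℕ} {A : Set (Fin d → ℝ)} (hA : IsObject A) {h : ℝ}
    (hh : cubeSize A < h) : ∀ x ∈ A, ∀ y ∈ A, dist x y < h := by
  have hne : {r : ℝ | 0 ≤ r ∧ ∃ c : Fin d → ℝ, A ⊆ cube c r}.Nonempty := by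
    obtain ⟨R, hR⟩ := hA.2.1.isBounded.subset_closedBall 0
    refine ⟨2 * max R 0, by positivity, 0, ?_⟩
    intro x hx
    have := hR hx
    simp only [Metric.mem_closedBall] at this
    simp only [cube, Set.mem_ofPred_eq]
    have := le_max_left R 0
    linarith
  obtain ⟨r, ⟨_, c, hc⟩, hr⟩ := exists_lt_of_csInf_lt hne hh
  intro x hx y hy
  have h1 := hc hx
  have h2 := hc hy
  simp only [cube, Set.mem_ofPred_eq] at h1 h2
  have := dist_triangle_right x y c
  linarith

lemma sphere_count {d ρ : ℕ} {V : Finset (Set (Fin d → ℝ))} (hV : Good ρ V)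
    (p : Fin d → ℝ) (h : ℝ) (hh : 0 < h) (N M : ℕ) (hM : 0 < M) (hMN : M ≤ 2 * N) :
    (V.filter (fun A => h ≤ cubeSize A ∧ ∃ x ∈ A, dist x p = M * h)).card ≤
      ρ * (d * (2 * (4 * N + 1) ^ (d - 1))) := by
  let G : Fin d → Finset (Fin d → ℤ) := fun j =>
    Fintype.piFinset (fun i => if i = j then {(M : ℤ), -(M : ℤ)} else Finset.Icc (-(2 * N : ℤ)) (2 * N))
  have hGc : ∀ j, (G j).card ≤ 2 * (4 * N + 1) ^ (d - 1) := by
    intro j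
    simp only [G, Fintype.card_piFinset]
    rw [← Finset.mul_prod_erase Finset.univ _ (Finset.mem_univ j)]
    apply Nat.mul_le_mul
    · simp only [if_true]; exact Finset.card_le_two
    · rw [Finset.prod_congr rfl (g := fun _ => 4 * N + 1)]
      · simp [Finset.card_erase_of_mem]
      · intro i hi
        rw [if_neg (Finset.ne_of_mem_erase hi), Int.card_Icc]
        omega
  let U : Finset (Fin d → ℤ) := Finset.univ.biUnion G
  have hUc : U.card ≤ d * (2 * (4 * N + 1) ^ (d - 1)) := by
    refine Finset.card_biUnion_le.trans ?_
    refine (Finset.sum_le_sum (fun j _ => hGc j)).trans ?_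
    simp
  have hsub : V.filter (fun A => h ≤ cubeSize A ∧ ∃ x ∈ A, dist x p = M * h) ⊆
      U.biUnion (fun m => V.filter (fun A => (A ∩ cube (fun i => p i + m i * h) h).Nonempty ∧ h ≤ cubeSize A)) := by
    intro A hA
    simp only [Finset.mem_filter] at hA
    obtain ⟨hAV, hs, x, hx, hxp⟩ := hA
    have hMh : 0 < (M : ℝ) * h := by positivity
    have hle : ∀ i, |x i - p i| ≤ M * h := by
      intro i
      rw [← Real.dist_eq, ← hxp]
      exact dist_le_pi_dist x p i
    obtain ⟨j, hj⟩ : ∃ j, |x j - p j| = M * h := by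
      by_contra hcon
      push Not at hcon
      have : dist x p < M * h := by
        rw [dist_pi_lt_iff hMh]
        intro i
        rw [Real.dist_eq]
        exact lt_of_le_of_ne (hle i) (hcon i)
      linarith
    let m : Fin d → ℤ := fun i => round ((x i - p i) / h)
    have hm : ∀ i, |x i - (p i + m i * h)| ≤ h / 2 := by
      intro i
      have h1 := abs_sub_round ((x i - p i) / h)
      have h2 : x i - (p i + m i * h) = ((x i - p i) / h - round ((x i - p i) / h)) * h := by
        simp only [m]; field_simp; ring
      rw [h2, abs_mul, abs_of_pos hh]
      nlinarith
    have hmb : ∀ i, -(M:ℤ) ≤ m i ∧ m i ≤ M := by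
      intro i
      have h1 := abs_le.mp (hle i)
      have h3 : (x i - p i) / h ≤ M := by rw [div_le_iff₀ hh]; linarith
      have h4 : -(M:ℝ) ≤ (x i - p i) / h := by rw [le_div_iff₀ hh]; linarith
      simp only [m, round_eq]
      constructor
      · rw [Int.le_floor]; push_cast; linarith
      · rw [← Int.lt_add_one_iff, Int.floor_lt]; push_cast; linarith
    simp only [Finset.mem_biUnion, Finset.mem_filter]
    refine ⟨m, ?_, hAV, ⟨x, hx, ?_⟩, hs⟩
    · simp only [U, Finset.mem_biUnion, G, Fintype.mem_piFinset]
      refine ⟨j, Finset.mem_univ _, fun i => ?_⟩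
      split_ifs with hij
      · subst hij
        simp only [Finset.mem_insert, Finset.mem_singleton]
        rcases (abs_eq hMh.le).mp hj with h1 | h1
        · left
          simp only [m, h1]
          rw [mul_div_cancel_right₀ _ hh.ne']
          exact round_natCast M
        · right
          simp only [m, h1]
          rw [neg_div, mul_div_cancel_right₀ _ hh.ne']
          have := round_intCast (α := ℝ) (-(M:ℤ))
          push_cast at this
          exact this
      · have := hmb i
        rw [Finset.mem_Icc]
        omega
    · simp only [cube, Set.mem_ofPred_eq]
      rw [dist_pi_le_iff (by positivity)]
      intro i
      rw [Real.dist_eq]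
      exact hm i
  refine (Finset.card_le_card hsub).trans ?_
  refine (Finset.card_biUnion_le_card_mul _ _ ρ (fun m _ => hV.2.2 _ h hh)).trans ?_
  rw [mul_comm]
  exact Nat.mul_le_mul_left _ hUc

lemma exists_N {d : ℕ} (hd : 1 ≤ d) (n : ℕ) (hn : 1 ≤ n) : ∃ N : ℕ, 0 < N ∧
    (n : ℝ) / N ≤ (n : ℝ) ^ (1 - 1 / (d : ℝ)) ∧
    ((4 * N + 1 : ℕ) : ℝ) ^ (d - 1) ≤ 10 ^ (d - 1) * (n : ℝ) ^ (1 - 1 / (d : ℝ)) := by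
  have hn' : (1:ℝ) ≤ n := by exact_mod_cast hn
  have hd' : (1:ℝ) ≤ d := by exact_mod_cast hd
  have hx : (1:ℝ) ≤ (n:ℝ) ^ (1 / (d:ℝ)) := Real.one_le_rpow hn' (by positivity)
  have hN1 := Nat.le_ceil ((n:ℝ) ^ (1 / (d:ℝ)))
  have hN2 := Nat.ceil_lt_add_one (a := (n:ℝ) ^ (1 / (d:ℝ))) (by linarith)
  set x := (n:ℝ) ^ (1 / (d:ℝ)) with hxdef
  set N := ⌈x⌉₊
  have hNpos : (0:ℝ) < N := by linarith
  refine ⟨N, by exact_mod_cast hNpos, ?_, ?_⟩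
  · rw [Real.rpow_sub (by linarith), Real.rpow_one]
    exact div_le_div_of_nonneg_left (by linarith) (by linarith) hN1
  · have h1 : ((4 * N + 1 : ℕ) : ℝ) ≤ 10 * x := by push_cast; linarith
    have h2 : (n : ℝ) ^ (1 - 1 / (d : ℝ)) = x ^ (d - 1) := by
      rw [hxdef, ← Real.rpow_natCast, ← Real.rpow_mul (by linarith)]
      congr 1
      rw [Nat.cast_sub hd]
      field_simp
      simp
    rw [h2, ← mul_pow]
    exact pow_le_pow_left₀ (by positivity) h1 _

lemma sep {d : ℕ} (hd : 1 ≤ d) (ρ : ℕ) (V : Finset (Set (Fin d → ℝ))) (hV : Good ρ V)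
    (hc : (4 * 9 ^ d : ℝ) < V.card) :
    ∃ I O Y : Finset (Set (Fin d → ℝ)), I ⊆ V ∧ O ⊆ V ∧ V ⊆ I ∪ O ∪ Y ∧
        (∀ a ∈ I, ∀ b ∈ O, Disjoint a b) ∧
        (I.card : ℝ) ≤ (1 - 1 / (2 * 9 ^ d)) * V.card ∧
        (O.card : ℝ) ≤ (1 - 1 / (2 * 9 ^ d)) * V.card ∧
        (Y.card : ℝ) ≤ (1 + ρ * (d * (2 * 10 ^ (d-1)))) * (V.card : ℝ) ^ (1 - 1 / (d : ℝ)) := by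
  have hB1 : (1:ℝ) ≤ 9 ^ d := one_le_pow₀ (by norm_num)
  have hBpos : (0:ℝ) < 2 * 9 ^ d := by positivity
  set n := V.card with hn
  have hn1 : 1 ≤ n := by
    have : (1:ℝ) < n := by linarith
    have : 1 < n := by exact_mod_cast this
    omega
  -- representative points
  have hrep : ∀ A : Set (Fin d → ℝ), ∃ x, A ∈ V → x ∈ A := by
    intro A
    by_cases hA : A ∈ V
    · obtain ⟨x, hx⟩ := (hV.1 A hA).1
      exact ⟨x, fun _ => hx⟩
    · exact ⟨0, fun h => absurd h hA⟩
  choose x hx using hrep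
  set k := ⌈(n : ℝ) / (2 * 9 ^ d)⌉₊ with hk
  have hk1 : (n : ℝ) / (2 * 9 ^ d) ≤ k := Nat.le_ceil _
  have hk2 : (k : ℝ) < (n : ℝ) / (2 * 9 ^ d) + 1 := Nat.ceil_lt_add_one (by positivity)
  have hk3 : 2 < k := by
    have : (2:ℝ) < (n : ℝ) / (2 * 9 ^ d) := by rw [lt_div_iff₀ hBpos]; linarith
    have : (2:ℝ) < k := by linarith
    exact_mod_cast this
  have hkn : k ≤ n := by
    have : (n : ℝ) / (2 * 9 ^ d) ≤ n := div_le_self (by positivity) (by linarith)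
    exact Nat.ceil_le.mpr this
  obtain ⟨A0, hA0, r, hr0, hr1, hr2⟩ := exists_cluster V x k (by omega) hkn
  set p := x A0 with hp
  have hr : 0 < r := by
    rcases hr0.lt_or_eq with h | h
    · exact h
    · exfalso
      have hs : V.filter (fun C => dist (x C) p ≤ r) ⊆ V.filter (fun A => p ∈ A) := by
        intro C hC
        simp only [Finset.mem_filter] at hC ⊢
        refine ⟨hC.1, ?_⟩
        have : x C = p := by
          rw [← dist_le_zero]; rw [h]; exact hC.2
        rw [← this]
        exact hx C hC.1
      have := (Finset.card_le_card hs).trans (hV.2.1 p)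
      omega
  obtain ⟨N, hN, hN1, hN2⟩ := exists_N hd n hn1
  have hNpos : (0:ℝ) < N := by exact_mod_cast hN
  set h := r / N with hh
  have hhpos : 0 < h := by positivity
  have hNh : N * h = r := by rw [hh]; field_simp
  -- small crossing objects
  let Sm : ℕ → Finset (Set (Fin d → ℝ)) := fun i =>
    V.filter (fun A => cubeSize A < h ∧ ∃ y ∈ A, dist y p = ((N + i : ℕ) : ℝ) * h)
  have hSm : ∃ i ∈ Finset.range N, ((Sm i).card : ℝ) ≤ n / N := by
    have hsum : ∑ i ∈ Finset.range N, ((Sm i).card : ℝ) ≤ ∑ i ∈ Finset.range N, (n : ℝ) / N := by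
      rw [Finset.sum_const, Finset.card_range, nsmul_eq_mul, mul_div_cancel₀ _ hNpos.ne']
      rw [← Nat.cast_sum, ← Finset.card_biUnion]
      · exact_mod_cast Finset.card_le_card (Finset.biUnion_subset.mpr (fun i _ => Finset.filter_subset _ _))
      · intro i _ j _ hij
        rw [Function.onFun, Finset.disjoint_left]
        intro A hAi hAj
        simp only [Sm, Finset.mem_filter] at hAi hAj
        obtain ⟨hAV, hs, y, hy, hyd⟩ := hAi
        obtain ⟨-, -, z, hz, hzd⟩ := hAj
        have hyz := dist_lt_of_cubeSize_lt (hV.1 A hAV) hs y hy z hz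
        have h1 : |dist y p - dist z p| < h := lt_of_le_of_lt (abs_dist_sub_le y z p) hyz
        rw [hyd, hzd, ← sub_mul, abs_mul, abs_of_pos hhpos] at h1
        have h2 : |((N + i : ℕ) : ℝ) - ((N + j : ℕ) : ℝ)| < 1 := by
          by_contra hcon
          push Not at hcon
          nlinarith
        have h3 : |((N + i : ℕ) : ℤ) - ((N + j : ℕ) : ℤ)| < 1 := by exact_mod_cast h2
        rw [Int.abs_lt_one_iff] at h3
        omega
    exact Finset.exists_le_of_sum_le ⟨0, Finset.mem_range.mpr hN⟩ hsum
  obtain ⟨i, hi, hSmi⟩ := hSm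
  rw [Finset.mem_range] at hi
  set t := ((N + i : ℕ) : ℝ) * h with ht
  have htr : r ≤ t := by
    rw [ht, ← hNh]; push_cast; nlinarith [(Nat.cast_nonneg i : (0:ℝ) ≤ i)]
  have ht2r : t ≤ 2 * r := by
    have : (i:ℝ) ≤ N := by exact_mod_cast hi.le
    rw [ht, ← hNh]; push_cast; nlinarith
  let I := V.filter (fun A => ∀ y ∈ A, dist y p < t)
  let O := V.filter (fun A => ∀ y ∈ A, t < dist y p)
  let La := V.filter (fun A => h ≤ cubeSize A ∧ ∃ y ∈ A, dist y p = ((N + i : ℕ) : ℝ) * h)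
  refine ⟨I, O, Sm i ∪ La, Finset.filter_subset _ _, Finset.filter_subset _ _, ?_, ?_, ?_, ?_, ?_⟩
  · intro A hA
    simp only [Finset.mem_union, I, O, Sm, La, Finset.mem_filter, hA, true_and]
    by_cases hcr : ∃ y ∈ A, dist y p = t
    · right
      rcases lt_or_ge (cubeSize A) h with h1 | h1
      · exact Or.inl ⟨h1, hcr⟩
      · exact Or.inr ⟨h1, hcr⟩
    · left
      by_contra hcon
      push Not at hcon hcr
      obtain ⟨⟨y, hy, hyt⟩, ⟨z, hz, hzt⟩⟩ := hcon
      have hpre := (hV.1 A hA).2.2.isPreconnected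
      have := hpre.intermediate_value hz hy (f := fun y => dist y p)
        (by fun_prop)
      obtain ⟨u, hu, hut⟩ := this ⟨hzt, hyt⟩
      exact hcr u hu hut
  · intro a ha b hb
    simp only [I, O, Finset.mem_filter] at ha hb
    rw [Set.disjoint_left]
    intro y hya hyb
    have := ha.2 y hya
    have := hb.2 y hyb
    linarith
  · -- inside count
    have hI : I.card ≤ (k - 1) * 9 ^ d := by
      let g : Set (Fin d → ℝ) → (Fin d → ℤ) := fun A j => ⌊(x A j - p j) / (r / 2)⌋
      have himg : I.image g ⊆ Fintype.piFinset (fun _ => Finset.Icc (-4 : ℤ) 4) := by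
        intro m hm
        simp only [Finset.mem_image] at hm
        obtain ⟨A, hA, rfl⟩ := hm
        simp only [I, Finset.mem_filter] at hA
        have h1 := hA.2 (x A) (hx A hA.1)
        rw [Fintype.mem_piFinset]
        intro j
        have h2 := (dist_le_pi_dist (x A) p j).trans (h1.le.trans ht2r)
        rw [Real.dist_eq, abs_le] at h2
        rw [Finset.mem_Icc]
        simp only [g]
        constructor
        · rw [Int.le_floor, le_div_iff₀ (by linarith)]; push_cast; linarith
        · rw [← Int.lt_add_one_iff, Int.floor_lt, div_lt_iff₀ (by linarith)]; push_cast; linarith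
      have hcard : (I.image g).card ≤ 9 ^ d := by
        refine (Finset.card_le_card himg).trans ?_
        rw [Fintype.card_piFinset]
        simp
      refine (Finset.card_le_mul_card_image (f := g) I (k - 1) ?_).trans (Nat.mul_le_mul_left _ hcard)
      intro m hm
      have := hr2 (I.filter (fun A => g A = m))
        ((Finset.filter_subset _ _).trans (Finset.filter_subset _ _)) (r / 2) (by linarith) ?_
      · omega
      · intro a ha b hb
        simp only [Finset.mem_filter] at ha hb
        rw [dist_pi_le_iff (by linarith)]
        intro j
        have e : ⌊(x a j - p j) / (r / 2)⌋ = ⌊(x b j - p j) / (r / 2)⌋ := by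
          have : g a j = g b j := by rw [ha.2, hb.2]
          exact this
        have e2 := Int.abs_sub_lt_one_of_floor_eq_floor e
        rw [← sub_div, abs_div, abs_of_pos (by linarith : 0 < r / 2), div_lt_one (by linarith)] at e2
        rw [Real.dist_eq]
        have : x a j - p j - (x b j - p j) = x a j - x b j := by ring
        rw [this] at e2
        exact e2.le
    have hI' : (I.card : ℝ) ≤ (k - 1) * 9 ^ d := by
      have : (I.card : ℝ) ≤ ((k - 1 : ℕ) : ℝ) * 9 ^ d := by exact_mod_cast hI
      rwa [Nat.cast_sub (by omega), Nat.cast_one] at this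
    have h3 : ((k:ℝ) - 1) * 9 ^ d ≤ n / 2 := by
      calc ((k:ℝ) - 1) * 9 ^ d ≤ ((n : ℝ) / (2 * 9 ^ d)) * 9 ^ d := by
            apply mul_le_mul_of_nonneg_right _ (by positivity); linarith
        _ = n / 2 := by field_simp
    have h4 : (1:ℝ) / (2 * 9 ^ d) ≤ 1 / 2 := by
      apply one_div_le_one_div_of_le (by norm_num); linarith
    have : (0:ℝ) ≤ n := by positivity
    nlinarith
  · have hO : O.card + k ≤ n := by
      have h1 : Disjoint O (V.filter (fun C => dist (x C) p ≤ r)) := by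
        rw [Finset.disjoint_left]
        intro A hA hA'
        simp only [O, Finset.mem_filter] at hA hA'
        have := hA.2 (x A) (hx A hA.1)
        linarith [hA'.2]
      have h2 := Finset.card_le_card (Finset.union_subset (Finset.filter_subset (fun A => ∀ y ∈ A, t < dist y p) V)
        (Finset.filter_subset (fun C => dist (x C) p ≤ r) V))
      rw [Finset.card_union_of_disjoint h1] at h2
      change O.card + _ ≤ n at h2
      omega
    have hO' : (O.card : ℝ) + k ≤ n := by exact_mod_cast hO
    have : (1 - 1 / (2 * 9 ^ d)) * (n:ℝ) = n - n / (2 * 9 ^ d) := by ring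
    rw [this]
    linarith
  · have h1 : La.card ≤ ρ * (d * (2 * (4 * N + 1) ^ (d - 1))) :=
      sphere_count hV p h hhpos N (N + i) (by omega) (by omega)
    have h1' : (La.card : ℝ) ≤ ρ * (d * (2 * ((4 * N + 1 : ℕ) : ℝ) ^ (d - 1))) := by
      exact_mod_cast h1
    have h2 : ((Sm i ∪ La).card : ℝ) ≤ (Sm i).card + La.card := by
      exact_mod_cast Finset.card_union_le _ _
    have h3 : (ρ : ℝ) * (d * (2 * ((4 * N + 1 : ℕ) : ℝ) ^ (d - 1))) ≤
        ρ * (d * (2 * (10 ^ (d - 1) * (n : ℝ) ^ (1 - 1 / (d : ℝ))))) := by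
      gcongr
    calc ((Sm i ∪ La).card : ℝ) ≤ (n : ℝ) ^ (1 - 1 / (d : ℝ)) +
        ρ * (d * (2 * (10 ^ (d - 1) * (n : ℝ) ^ (1 - 1 / (d : ℝ))))) := by linarith
      _ = _ := by ring

lemma good_union {d f : ℕ} (S₁ S₂ : Finset (Set (Fin d → ℝ)))
    (hf1 : IsFatFam f S₁) (hf2 : IsFatFam f S₂)
    (ho1 : ∀ A ∈ S₁, IsObject A) (ho2 : ∀ A ∈ S₂, IsObject A)
    (hd1 : (S₁ : Set (Set (Fin d → ℝ))).Pairwise Disjoint)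
    (hd2 : (S₂ : Set (Set (Fin d → ℝ))).Pairwise Disjoint) : Good (2 * f) (S₁ ∪ S₂) := by
  have pt : ∀ S : Finset (Set (Fin d → ℝ)), (S : Set (Set (Fin d → ℝ))).Pairwise Disjoint →
      ∀ x, (S.filter (fun A => x ∈ A)).card ≤ 1 := by
    intro S hS x
    rw [Finset.card_le_one]
    intro a ha b hb
    simp only [Finset.mem_filter] at ha hb
    by_contra hab
    exact Set.disjoint_left.mp (hS (Finset.mem_coe.mpr ha.1) (Finset.mem_coe.mpr hb.1) hab) ha.2 hb.2
  have fat : ∀ S : Finset (Set (Fin d → ℝ)), IsFatFam f S →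
      (S : Set (Set (Fin d → ℝ))).Pairwise Disjoint → ∀ (c : Fin d → ℝ) (r : ℝ), 0 < r →
      (S.filter (fun A => (A ∩ cube c r).Nonempty ∧ r ≤ cubeSize A)).card ≤ f := by
    intro S hS hdS c r hr
    obtain ⟨P, hP, hPS⟩ := hS c r hr
    have : S.filter (fun A => (A ∩ cube c r).Nonempty ∧ r ≤ cubeSize A) ⊆
        P.biUnion (fun p => S.filter (fun A => p ∈ A)) := by
      intro A hA
      simp only [Finset.mem_filter, Finset.mem_biUnion] at hA ⊢
      obtain ⟨p, hp, hpA⟩ := hPS A hA.1 hA.2.1 hA.2.2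
      exact ⟨p, hp, hA.1, hpA⟩
    refine (Finset.card_le_card this).trans ?_
    refine (Finset.card_biUnion_le_card_mul _ _ 1 (fun p _ => pt S hdS p)).trans ?_
    omega
  refine ⟨?_, ?_, ?_⟩
  · intro A hA
    rcases Finset.mem_union.mp hA with h | h
    · exact ho1 A h
    · exact ho2 A h
  · intro x
    rw [Finset.filter_union]
    have := Finset.card_union_le (S₁.filter (fun A => x ∈ A)) (S₂.filter (fun A => x ∈ A))
    have := pt S₁ hd1 x
    have := pt S₂ hd2 x
    omega
  · intro c r hr
    rw [Finset.filter_union]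
    have := fat S₁ hf1 hd1 c r hr
    have := fat S₂ hf2 hd2 c r hr
    refine (Finset.card_union_le _ _).trans ?_
    omega

end FatMix
/-- Lemma `mix_result` (combinatorial content): fat objects admit a MIX sequence with
`Γ(n) = O(n^{1-1/d} log n)`. -/
theorem fat_objects_have_MIX {d : ℕ} (hd : 1 ≤ d) (f : ℕ) :
    ∃ C : ℝ, 0 < C ∧
      ∀ S₁ S₂ : Finset (Set (Fin d → ℝ)),
        IsFatFam f S₁ → IsFatFam f S₂ →
        (∀ A ∈ S₁, IsObject A) → (∀ A ∈ S₂, IsObject A) →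
        (S₁ : Set (Set (Fin d → ℝ))).Pairwise Disjoint →
        (S₂ : Set (Set (Fin d → ℝ))).Pairwise Disjoint →
        ∀ n : ℕ, n = S₁.card + S₂.card → 2 ≤ n →
          ∃ (m : ℕ) (J : ℕ → Finset (Set (Fin d → ℝ))),
            m ≤ n ∧ J 0 = S₁ ∧ J m = S₂ ∧
            (∀ i ≤ m, J i ⊆ S₁ ∪ S₂) ∧
            (∀ i ≤ m, ((J i : Set (Set (Fin d → ℝ))).Pairwise Disjoint)) ∧
            (∀ i < m, (symmDiff (J i) (J (i + 1))).card = 1) ∧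
            (∀ i ≤ m,
              (min S₁.card S₂.card : ℝ) - C * (n : ℝ) ^ (1 - 1 / (d : ℝ)) * Real.log n ≤
                ((J i).card : ℝ)) := by
  set q : ℝ := 1 - 1 / (2 * 9 ^ d) with hq
  set B : ℝ := 4 * 9 ^ d with hB
  set K : ℝ := 1 + ((2 * f : ℕ) : ℝ) * (d * (2 * 10 ^ (d-1))) with hK
  have h9 : (1:ℝ) ≤ 9 ^ d := one_le_pow₀ (by norm_num)
  have hqi : (0:ℝ) < 1 / (2 * 9 ^ d) := by positivity
  have hq2 : (1:ℝ) / (2 * 9 ^ d) ≤ 1 / 2 := by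
    apply one_div_le_one_div_of_le (by norm_num); linarith
  have hq0 : 0 < q := by rw [hq]; linarith
  have hq1 : q < 1 := by rw [hq]; linarith
  have hB0 : 0 < B := by positivity
  have hB1 : 1 ≤ B := by rw [hB]; linarith
  have hK0 : 0 < K := by positivity
  set g : ℝ := -Real.log q with hg
  have hg0 : 0 < g := by rw [hg]; linarith [Real.log_neg hq0 hq1]
  have hl2 : 0 < Real.log 2 := Real.log_pos (by norm_num)
  refine ⟨2 * ((B + K) / Real.log 2 + K / g), by positivity, ?_⟩
  intro S₁ S₂ hf1 hf2 ho1 ho2 hd1 hd2 n hn hn2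
  have hgood := FatMix.good_union S₁ S₂ hf1 hf2 ho1 ho2 hd1 hd2
  have hnr : (2:ℝ) ≤ n := by exact_mod_cast hn2
  set L := ⌈Real.log n / g⌉₊ with hL
  have hln : Real.log 2 ≤ Real.log n := Real.log_le_log (by norm_num) hnr
  have hL1 : Real.log n / g ≤ L := Nat.le_ceil _
  have hL2 : (L : ℝ) < Real.log n / g + 1 :=
    Nat.ceil_lt_add_one (div_nonneg (by linarith) hg0.le)
  have hcardn : (S₁ ∪ S₂).card ≤ n := by rw [hn]; exact Finset.card_union_le _ _
  have hqL : (n : ℝ) * q ^ L ≤ 1 := by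
    have h1 : Real.log (n * q ^ L) ≤ 0 := by
      rw [Real.log_mul (by positivity) (by positivity), Real.log_pow]
      rw [div_le_iff₀ hg0] at hL1
      have : Real.log q = -g := by rw [hg]; ring
      rw [this]; linarith
    have h2 : 0 < (n : ℝ) * q ^ L := by positivity
    exact (Real.log_nonpos_iff h2.le).mp h1
  obtain ⟨T, l, r, hlr, hadj, hbag⟩ := FatMix.pd_of_sep hd (2 * f) B K q hB0.le hK0.le hq0
    (fun V hV hc => FatMix.sep hd (2 * f) V hV hc) n (by omega) L (S₁ ∪ S₂) hgood hcardn (by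
      have : (((S₁ ∪ S₂).card : ℕ) : ℝ) ≤ n := by exact_mod_cast hcardn
      have h3 : 0 < q ^ L := by positivity
      nlinarith)
  set M := (n : ℝ) ^ (1 - 1 / (d : ℝ)) with hM
  have hM0 : 0 ≤ M := by positivity
  have hw0 : 0 ≤ (B + L * K) * M := by positivity
  obtain ⟨m, J, hm, hJ0, hJm, hJs, hJd, hJc, hJb⟩ := FatMix.mix_of_pd S₁ S₂ Disjoint T l r
    ⌊(B + L * K) * M⌋₊ hlr (fun u hu v hv huv => hd1 (Finset.mem_coe.mpr hu) (Finset.mem_coe.mpr hv) huv)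
    (fun u hu v hv huv => hd2 (Finset.mem_coe.mpr hu) (Finset.mem_coe.mpr hv) huv)
    (fun u v h => h.symm) hadj (fun t => Nat.le_floor (hbag t))
  refine ⟨m, J, by omega, hJ0, hJm, hJs, ?_, hJc, ?_⟩
  · intro i hi u hu v hv huv
    exact hJd i hi u (Finset.mem_coe.mp hu) v (Finset.mem_coe.mp hv) huv
  · intro i hi
    have h1 := hJb i hi
    have h2 : (min S₁.card S₂.card : ℝ) ≤ (J i).card + 2 * (⌊(B + L * K) * M⌋₊ : ℝ) := by
      exact_mod_cast h1
    have h3 := Nat.floor_le hw0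
    have h4 : B + L * K ≤ ((B + K) / Real.log 2 + K / g) * Real.log n := by
      have e1 : B + K ≤ (B + K) / Real.log 2 * Real.log n := by
        rw [div_mul_eq_mul_div, le_div_iff₀ hl2]
        exact mul_le_mul_of_nonneg_left hln (by linarith)
      have e2 : L * K ≤ (Real.log n / g + 1) * K := mul_le_mul_of_nonneg_right hL2.le hK0.le
      have e3 : (Real.log n / g + 1) * K = K / g * Real.log n + K := by ring
      linarith
    have h5 := mul_le_mul_of_nonneg_right h4 hM0
    have h6 : 2 * ((B + K) / Real.log 2 + K / g) * M * Real.log n =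
      2 * (((B + K) / Real.log 2 + K / g) * Real.log n * M) := by ring
    rw [h6]
    linarith
end

section
/- For every n ≥ 1 there exist finite families A and B of n closed axis-aligned rectangles in ℝ² each, with A pairwise disjoint and B pairwise disjoint, such that the following holds: for every m and every sequence I₀, I₁, …, I_m of pairwise disjoint subfamilies of A ∪ B with I₀ = A, I_m = B, and consecutive families differing in exactly one member (|I_j Δ I_{j+1}| = 1 for all j < m), there exists an index j with I_j = ∅. Consequently, there is no MIX function for axis-aligned rectangles with Γ(n) < n. -/
open scoped Classical

/-- A closed axis-aligned rectangle in the plane: a product of two nondegenerate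
closed intervals. -/
def IsRect (R : Set (ℝ × ℝ)) : Prop :=
  ∃ a₁ b₁ a₂ b₂ : ℝ, a₁ < b₁ ∧ a₂ < b₂ ∧ R = Set.Icc a₁ b₁ ×ˢ Set.Icc a₂ b₂

def vStrip (n i : ℕ) : Set (ℝ × ℝ) :=
  Set.Icc (2 * i : ℝ) (2 * i + 1) ×ˢ Set.Icc (-1 : ℝ) (2 * n)

def hStrip (n i : ℕ) : Set (ℝ × ℝ) :=
  Set.Icc (-1 : ℝ) (2 * n) ×ˢ Set.Icc (2 * i : ℝ) (2 * i + 1)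

lemma strip_sep {i k : ℕ} {x : ℝ} (h1 : (2 * i : ℝ) ≤ x) (h2 : x ≤ 2 * i + 1)
    (h3 : (2 * k : ℝ) ≤ x) (h4 : x ≤ 2 * k + 1) : i = k := by
  have a : (2 * i : ℝ) ≤ 2 * k + 1 := by linarith
  have b : (2 * k : ℝ) ≤ 2 * i + 1 := by linarith
  norm_cast at a b
  omega

lemma vStrip_disj (n : ℕ) {i k : ℕ} (h : i ≠ k) : Disjoint (vStrip n i) (vStrip n k) := by
  rw [Set.disjoint_left]
  rintro ⟨x, y⟩ ⟨⟨h1, h2⟩, -⟩ ⟨⟨h3, h4⟩, -⟩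
  exact h (strip_sep h1 h2 h3 h4)

lemma hStrip_disj (n : ℕ) {i k : ℕ} (h : i ≠ k) : Disjoint (hStrip n i) (hStrip n k) := by
  rw [Set.disjoint_left]
  rintro ⟨x, y⟩ ⟨-, ⟨h1, h2⟩⟩ ⟨-, ⟨h3, h4⟩⟩
  exact h (strip_sep h1 h2 h3 h4)

lemma mem_vStrip (n i : ℕ) {y : ℝ} (h : -1 ≤ y) (h' : y ≤ 2 * n) :
    ((2 * i : ℝ), y) ∈ vStrip n i :=
  ⟨⟨le_refl _, by simp⟩, ⟨h, h'⟩⟩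

lemma mem_hStrip (n i : ℕ) {y : ℝ} (h : -1 ≤ y) (h' : y ≤ 2 * n) :
    (y, (2 * i : ℝ)) ∈ hStrip n i :=
  ⟨⟨h, h'⟩, ⟨le_refl _, by simp⟩⟩

lemma neg_one_le_two_mul (n : ℕ) : (-1 : ℝ) ≤ 2 * n := by
  have : (0 : ℝ) ≤ n := n.cast_nonneg
  linarith

lemma vStrip_inj (n : ℕ) : Function.Injective (vStrip n) := by
  intro i k h
  by_contra hne
  have hm := mem_vStrip n i (le_refl (-1)) (neg_one_le_two_mul n)
  exact Set.disjoint_left.1 (vStrip_disj n hne) hm (h ▸ hm)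

lemma hStrip_inj (n : ℕ) : Function.Injective (hStrip n) := by
  intro i k h
  by_contra hne
  have hm := mem_hStrip n i (le_refl (-1)) (neg_one_le_two_mul n)
  exact Set.disjoint_left.1 (hStrip_disj n hne) hm (h ▸ hm)

lemma vStrip_ne_hStrip (n i k : ℕ) : vStrip n i ≠ hStrip n k := by
  intro h
  have hm := mem_vStrip n i (le_refl (-1)) (neg_one_le_two_mul n)
  rw [h] at hm
  have h2 : (2 * k : ℝ) ≤ -1 := hm.2.1
  have : (0 : ℝ) ≤ k := k.cast_nonneg
  linarith

lemma strips_meet (n : ℕ) {i k : ℕ} (hi : i < n) (hk : k < n) :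
    ¬ Disjoint (vStrip n i) (hStrip n k) := by
  have hi' : (i : ℝ) ≤ n := by exact_mod_cast hi.le
  have hk' : (k : ℝ) ≤ n := by exact_mod_cast hk.le
  intro h
  exact Set.disjoint_left.1 h (mem_vStrip n i (neg_one_le_two_mul k) (by linarith))
    (mem_hStrip n k (neg_one_le_two_mul i) (by linarith))

/-- Lemma `noapprox`: there is no MIX function for axis-aligned rectangles with
`Γ(n) < n`.  For every `n ≥ 1` there are pairwise disjoint families `A`, `B` of `n`
rectangles each such that every sequence of pairwise disjoint subfamilies of `A ∪ B`
going from `A` to `B` and changing exactly one member per step must pass through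
the empty family. -/
theorem no_mix_for_rectangles (n : ℕ) (hn : 1 ≤ n) :
    ∃ A B : Finset (Set (ℝ × ℝ)),
      A.card = n ∧ B.card = n ∧
      (∀ R ∈ A, IsRect R) ∧ (∀ R ∈ B, IsRect R) ∧
      (A : Set (Set (ℝ × ℝ))).Pairwise Disjoint ∧
      (B : Set (Set (ℝ × ℝ))).Pairwise Disjoint ∧
      ∀ (m : ℕ) (I : ℕ → Finset (Set (ℝ × ℝ))),
        I 0 = A → I m = B →
        (∀ j ≤ m, I j ⊆ A ∪ B) →
        (∀ j ≤ m, ((I j : Set (Set (ℝ × ℝ))).Pairwise Disjoint)) →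
        (∀ j < m, (symmDiff (I j) (I (j + 1))).card = 1) →
        ∃ j ≤ m, I j = ∅ := by
  classical
  refine ⟨(Finset.range n).image (vStrip n), (Finset.range n).image (hStrip n), ?_, ?_, ?_, ?_,
    ?_, ?_, ?_⟩
  · rw [Finset.card_image_of_injective _ (vStrip_inj n), Finset.card_range]
  · rw [Finset.card_image_of_injective _ (hStrip_inj n), Finset.card_range]
  · intro R hR
    obtain ⟨i, -, rfl⟩ := Finset.mem_image.1 hR
    exact ⟨_, _, _, _, by linarith, by linarith [(n.cast_nonneg : (0 : ℝ) ≤ n)], rfl⟩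
  · intro R hR
    obtain ⟨i, -, rfl⟩ := Finset.mem_image.1 hR
    exact ⟨_, _, _, _, by linarith [(n.cast_nonneg : (0 : ℝ) ≤ n)], by linarith, rfl⟩
  · intro R hR S hS hne
    obtain ⟨i, -, rfl⟩ := Finset.mem_image.1 (Finset.mem_coe.1 hR)
    obtain ⟨k, -, rfl⟩ := Finset.mem_image.1 (Finset.mem_coe.1 hS)
    exact vStrip_disj n (fun h => hne (by rw [h]))
  · intro R hR S hS hne
    obtain ⟨i, -, rfl⟩ := Finset.mem_image.1 (Finset.mem_coe.1 hR)
    obtain ⟨k, -, rfl⟩ := Finset.mem_image.1 (Finset.mem_coe.1 hS)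
    exact hStrip_disj n (fun h => hne (by rw [h]))
  · intro m I h0 hm hsub hdis hstep
    by_contra! hne
    have key : ∀ j ≤ m, I j ⊆ (Finset.range n).image (vStrip n) := by
      intro j
      induction j with
      | zero => intro _; rw [h0]
      | succ j ih =>
        intro hj
        have ihj := ih (by omega)
        intro R hR
        rcases Finset.mem_union.1 (hsub _ hj hR) with h | h
        · exact h
        exfalso
        obtain ⟨k, hk, rfl⟩ := Finset.mem_image.1 h
        obtain ⟨S, hS⟩ := Finset.nonempty_iff_ne_empty.2 (Finset.nonempty_iff_ne_empty.1 (hne j (by omega)))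
        obtain ⟨i, hi, rfl⟩ := Finset.mem_image.1 (ihj hS)
        have hS' : vStrip n i ∉ I (j + 1) := fun hc =>
          strips_meet n (Finset.mem_range.1 hi) (Finset.mem_range.1 hk)
            (hdis _ hj hc hR (vStrip_ne_hStrip n i k))
        have hR' : hStrip n k ∉ I j := by
          intro hc
          obtain ⟨l, -, hl⟩ := Finset.mem_image.1 (ihj hc)
          exact vStrip_ne_hStrip n l k hl
        have hcard := hstep j (by omega)
        exact vStrip_ne_hStrip n i k (Finset.card_le_one.1 hcard.le _
          (Finset.mem_symmDiff.2 (Or.inl ⟨hS, hS'⟩)) _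
          (Finset.mem_symmDiff.2 (Or.inr ⟨hR, hR'⟩)))
    have hB := key m le_rfl
    rw [hm] at hB
    obtain ⟨l, -, hl⟩ := Finset.mem_image.1
      (hB (Finset.mem_image_of_mem (hStrip n) (Finset.mem_range.2 hn)))
    exact vStrip_ne_hStrip n l 0 hl
end

section
/- Let V be a type and let A and B be finite families of subsets of V such that A ∩ B = ∅ (as families) and every member of A has nonempty intersection with every member of B. Let I₀, I₁, …, I_m be a sequence of pairwise disjoint subfamilies of A ∪ B with I₀ = A, I_m = B, and consecutive families differing in exactly one member (|I_j Δ I_{j+1}| = 1 for all j < m). Then there exists an index j with I_j = ∅. -/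
open scoped Classical

/-- Abstract combinatorial core of the MIX impossibility argument: if every member of
`A` intersects every member of `B`, then any sequence of pairwise disjoint subfamilies
of `A ∪ B` going from `A` to `B` and changing exactly one member per step passes
through the empty family. -/
theorem mix_through_empty {V : Type*} (A B : Finset (Set V))
    (hAB : A ∩ B = ∅)
    (hint : ∀ a ∈ A, ∀ b ∈ B, (a ∩ b).Nonempty)
    (m : ℕ) (I : ℕ → Finset (Set V))
    (h0 : I 0 = A) (hm : I m = B)
    (hsub : ∀ j ≤ m, I j ⊆ A ∪ B)
    (hdisj : ∀ j ≤ m, ((I j : Set (Set V)).Pairwise Disjoint))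
    (hstep : ∀ j < m, (symmDiff (I j) (I (j + 1))).card = 1) :
    ∃ j ≤ m, I j = ∅ := by
  by_contra hne
  push Not at hne
  have hnot : ∀ x ∈ A, x ∉ B := by
    intro x hx hy
    have : x ∈ A ∩ B := Finset.mem_inter.2 ⟨hx, hy⟩
    rw [hAB] at this
    simp at this
  have key : ∀ j, j ≤ m → I j ⊆ A := by
    intro j
    induction j with
    | zero => intro _; rw [h0]
    | succ k ih =>
      intro hk b hb
      by_contra hbA
      have hbB : b ∈ B := (Finset.mem_union.1 (hsub _ hk hb)).resolve_left hbA
      have ihk := ih (by omega)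
      obtain ⟨a, ha⟩ := Finset.nonempty_iff_ne_empty.2 (by simpa [Finset.nonempty_iff_ne_empty] using hne k (by omega))
      have haA := ihk ha
      have hab : a ≠ b := fun h => hbA (h ▸ haA)
      have ha' : a ∉ I (k + 1) := fun h =>
        Set.not_disjoint_iff_nonempty_inter.2 (hint a haA b hbB) (hdisj _ hk h hb hab)
      have hb' : b ∉ I k := fun h => hbA (ihk h)
      exact hab (Finset.card_le_one.1 (hstep k (by omega)).le a
        (Finset.mem_symmDiff.2 (Or.inl ⟨ha, ha'⟩)) b
        (Finset.mem_symmDiff.2 (Or.inr ⟨hb, hb'⟩)))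
  obtain ⟨b, hb⟩ := Finset.nonempty_iff_ne_empty.2 (by simpa [Finset.nonempty_iff_ne_empty] using hne m le_rfl)
  exact hnot b (key m le_rfl hb) (hm ▸ hb)
end

section
/- Let V be a type, δ ∈ ℕ, and let A and B be finite families of subsets of V such that A ∩ B = ∅ (as families) and every member of A has nonempty intersection with every member of B. Let I₀, I₁, …, I_m be a sequence of pairwise disjoint subfamilies of A ∪ B with I₀ = A, I_m = B, and |I_j Δ I_{j+1}| ≤ δ for all j < m. Then there exists an index j with |I_j| ≤ δ. -/
open scoped Classical

/-- Quantitative version of the flip argument (combinatorial core of Theorem `nomix`):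
if every member of `A` intersects every member of `B` and a sequence of pairwise
disjoint subfamilies of `A ∪ B` goes from `A` to `B` changing at most `δ` members
per step, then at some point the family has size at most `δ`. -/
theorem mix_small_at_flip {V : Type*} (δ : ℕ) (A B : Finset (Set V))
    (hAB : A ∩ B = ∅)
    (hint : ∀ a ∈ A, ∀ b ∈ B, (a ∩ b).Nonempty)
    (m : ℕ) (I : ℕ → Finset (Set V))
    (h0 : I 0 = A) (hm : I m = B)
    (hsub : ∀ j ≤ m, I j ⊆ A ∪ B)
    (hdisj : ∀ j ≤ m, ((I j : Set (Set V)).Pairwise Disjoint))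
    (hstep : ∀ j < m, (symmDiff (I j) (I (j + 1))).card ≤ δ) :
    ∃ j ≤ m, (I j).card ≤ δ := by
  by_contra! hcon
  have hd : ∀ x, x ∈ A → x ∈ B → False := by
    intro x hx hy
    have : x ∈ A ∩ B := Finset.mem_inter.2 ⟨hx, hy⟩
    rw [hAB] at this
    simp at this
  have key : ∀ j, j ≤ m → I j ⊆ A := by
    intro j
    induction j with
    | zero => intro _; rw [h0]
    | succ j ih =>
      intro hj
      have ihj := ih (by omega)
      by_contra hn
      obtain ⟨b, hb, hbA⟩ := Finset.not_subset.1 hn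
      have hbB : b ∈ B := (Finset.mem_union.1 (hsub _ hj hb)).resolve_left hbA
      have hsubs : I j ⊆ symmDiff (I j) (I (j + 1)) := by
        intro a ha
        rw [Finset.mem_symmDiff]
        refine Or.inl ⟨ha, fun ha' => ?_⟩
        have hne : a ≠ b := by
          rintro rfl
          exact hbA (ihj ha)
        have hdis : Disjoint a b := hdisj _ hj ha' hb hne
        exact (Set.not_disjoint_iff_nonempty_inter.2 (hint a (ihj ha) b hbB)) hdis
      have h1 := Finset.card_le_card hsubs
      have h2 := hstep j (by omega)
      have h3 := hcon j (by omega)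
      omega
  have hBA := key m le_rfl
  have h3 := hcon m le_rfl
  obtain ⟨b, hb⟩ := Finset.card_pos.1 (by omega : 0 < (I m).card)
  exact hd b (hBA hb) (hm ▸ hb)
end

section
/- Let S be a finite f-fat family of objects in ℝ^d that is pairwise disjoint, let c ∈ ℝ^d, and let q > 0 and y > 0. Then the number of members of S that have size at least y and intersect the boundary ∂□(c,q) is at most 2d·f·⌈q/y⌉^{d−1}. -/
open scoped Classical

theorem cell_aux (q y t : ℝ) (hq : 0 < q) (hy : 0 < y) (h0 : |t| ≤ q / 2) :
    ∃ k : Fin ⌈q / y⌉.toNat, |t - (-(q / 2) + ((k : ℕ) + 1 / 2) * y)| ≤ y / 2 := by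
  have hN : 0 < ⌈q / y⌉ := Int.ceil_pos.2 (div_pos hq hy)
  have hNc : ((⌈q / y⌉.toNat : ℕ) : ℝ) = (⌈q / y⌉ : ℝ) := by
    exact_mod_cast Int.toNat_of_nonneg hN.le
  have hle : q ≤ (⌈q / y⌉.toNat : ℝ) * y := by
    rw [hNc]
    exact (div_le_iff₀ hy).1 (Int.le_ceil _)
  obtain ⟨h1, h2⟩ := abs_le.1 h0
  generalize hM : ⌈q / y⌉.toNat = M at *
  have hM0 : 0 < M := by omega
  have hnn : 0 ≤ (t + q / 2) / y := div_nonneg (by linarith) hy.le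
  have hf1 := (le_div_iff₀ hy).1 (Nat.floor_le hnn)
  have hf2 := (div_lt_iff₀ hy).1 (Nat.lt_floor_add_one ((t + q / 2) / y))
  by_cases hk : ⌊(t + q / 2) / y⌋₊ < M
  · refine ⟨⟨_, hk⟩, ?_⟩
    rw [abs_le]
    constructor <;> simp only <;> nlinarith
  · have hk' : (M : ℝ) ≤ (⌊(t + q / 2) / y⌋₊ : ℝ) := by exact_mod_cast not_lt.1 hk
    have h3 : (M : ℝ) * y ≤ t + q / 2 := (mul_le_mul_of_nonneg_right hk' hy.le).trans hf1
    refine ⟨⟨M - 1, by omega⟩, ?_⟩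
    have : ((M - 1 : ℕ) : ℝ) = M - 1 := by
      rw [Nat.cast_sub hM0]; simp
    simp only [this]
    rw [abs_le]
    constructor <;> nlinarith

/-- The "big objects" bound in Lemma `getroot`: at most `2d·f·⌈q/y⌉^(d-1)` pairwise
disjoint objects of size at least `y` of an `f`-fat family can meet the boundary of
the hypercube `□(c,q)`. -/
theorem big_objects_on_boundary {d f : ℕ} (hd : 1 ≤ d)
    (S : Finset (Set (Fin d → ℝ)))
    (hfat : IsFatFam f S) (hobj : ∀ A ∈ S, IsObject A)
    (hdisj : (S : Set (Set (Fin d → ℝ))).Pairwise Disjoint)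
    (c : Fin d → ℝ) (q y : ℝ) (hq : 0 < q) (hy : 0 < y) :
    (({A : Set (Fin d → ℝ) | A ∈ S ∧ y ≤ cubeSize A ∧
        (A ∩ frontier (cube c q)).Nonempty}.ncard : ℤ)) ≤
      2 * d * f * ⌈q / y⌉ ^ (d - 1) := by
  obtain ⟨m, rfl⟩ : ∃ m, d = m + 1 := ⟨d - 1, by omega⟩
  have hN : 0 < ⌈q / y⌉ := Int.ceil_pos.2 (div_pos hq hy)
  let ctr : Fin (m + 1) × Bool × (Fin m → Fin ⌈q / y⌉.toNat) → (Fin (m + 1) → ℝ) := fun a =>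
    a.1.insertNth (c a.1 + if a.2.1 then q / 2 else -(q / 2))
      (fun j => c (a.1.succAbove j) + (-(q / 2) + (((a.2.2 j : Fin _) : ℕ) + 1 / 2) * y))
  choose P hPc hP using fun a => hfat (ctr a) y hy
  have hcov : ∀ x ∈ frontier (cube c q), ∃ a, x ∈ cube (ctr a) y := by
    intro x hx
    have hx' : dist x c = q / 2 := by
      have := Metric.frontier_closedBall_subset_sphere (x := c) (ε := q / 2) hx
      exact Metric.mem_sphere.1 this
    have hall : ∀ j, |x j - c j| ≤ q / 2 := fun j => by
      rw [← hx', ← Real.dist_eq]; exact dist_le_pi_dist x c j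
    obtain ⟨i, hi⟩ : ∃ i, |x i - c i| = q / 2 := by
      by_contra! hcon
      have : dist x c < q / 2 := (dist_pi_lt_iff (by linarith)).2 fun j => by
        rw [Real.dist_eq]; exact lt_of_le_of_ne (hall j) (hcon j)
      linarith
    choose k hk using fun j : Fin m => cell_aux q y _ hq hy (hall (i.succAbove j))
    have key : ∀ b : Bool, x i - c i = (if b then q / 2 else -(q / 2)) →
        x ∈ cube (ctr (i, b, k)) y := by
      intro b hb
      refine (dist_pi_le_iff (by linarith)).2 fun j => ?_
      rw [Real.dist_eq]
      refine Fin.succAboveCases i ?_ (fun j => ?_) j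
      · simp only [ctr, Fin.insertNth_apply_same]
        rw [← hb]; simp; linarith
      · simp only [ctr, Fin.insertNth_apply_succAbove]
        rw [← sub_sub]; exact hk j
    rcases (abs_eq (by linarith)).1 hi with h | h
    · exact ⟨_, key true (by simpa using h)⟩
    · exact ⟨_, key false (by simpa using h)⟩
  set T : Set (Set (Fin (m + 1) → ℝ)) := {A | A ∈ S ∧ y ≤ cubeSize A ∧
        (A ∩ frontier (cube c q)).Nonempty} with hT
  let U := Finset.univ.biUnion P
  have hpt : ∀ A ∈ T, ∃ p ∈ U, p ∈ A := by
    rintro A ⟨hAS, hAy, x, hxA, hxf⟩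
    obtain ⟨a, ha⟩ := hcov x hxf
    obtain ⟨p, hp, hpA⟩ := hP a A hAS ⟨x, hxA, ha⟩ hAy
    exact ⟨p, Finset.mem_biUnion.2 ⟨a, Finset.mem_univ _, hp⟩, hpA⟩
  choose! g hgU hgA using hpt
  have h1 : T.ncard ≤ U.card := by
    rw [← Set.ncard_coe_finset]
    refine Set.ncard_le_ncard_of_injOn g (fun A hA => hgU A hA) ?_ U.finite_toSet
    intro A hA B hB hAB
    by_contra hne
    exact Set.disjoint_left.1 (hdisj hA.1 hB.1 hne) (hgA A hA) (hAB ▸ hgA B hB)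
  have h2 : U.card ≤ ((m + 1) * (2 * ⌈q / y⌉.toNat ^ m)) * f := by
    refine (Finset.card_biUnion_le_card_mul _ _ f fun a _ => hPc a).trans (le_of_eq ?_)
    simp
  have h3 : (T.ncard : ℤ) ≤ (((m + 1) * (2 * ⌈q / y⌉.toNat ^ m)) * f : ℕ) := by
    exact_mod_cast h1.trans h2
  refine h3.trans (le_of_eq ?_)
  push_cast
  rw [Int.toNat_of_nonneg hN.le]
  ring
end
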